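/- arXiv:1506.03310 — 10 statements merged into one kernel-verified Lean document; each statement's English description precedes it below -/
import Mathlib

section
/- Let G be a simple graph and let C = v_0 v_1 … v_{t-1} v_0 be a non-extendable cycle of length t in G (subscripts modulo t). Suppose v_i and v_j (i ≠ j) are two distinct attachment vertices of C that have a common off-cycle neighbour x. Then v_{i+1} is not adjacent to v_{j+1} and v_{i-1} is not adjacent to v_{j-1}. -/
open SimpleGraph

/-- `G` has a cycle whose vertex set is exactly `s`. -/
def HasCycleOn {V : Type*} (G : SimpleGraph V) (s : Set V) : Prop :=
  ∃ (a : V) (c : G.Walk a a), c.IsCycle ∧ {x | x ∈ c.support} = s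

/-- An injective cyclic sequence of consecutively adjacent vertices contains, for every `n < t`,
the path through the `n + 1` vertices following `a`. -/
theorem exists_isPath_arc {V : Type*} {G : SimpleGraph V} {t : ℕ}
    {v : ZMod t → V} (hinj : Function.Injective v)
    (hadj : ∀ z : ZMod t, G.Adj (v z) (v (z + 1))) (a : ZMod t) (n : ℕ) (hn : n < t) :
    ∀ b, b = a + n → ∃ p : G.Walk (v a) (v b), p.IsPath ∧
      ∀ y, y ∈ p.support ↔ ∃ k : ℕ, k ≤ n ∧ v (a + k) = y := by
  induction n with
  | zero =>
    intro b hb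
    obtain rfl : b = a := by simpa using hb
    exact ⟨.nil, .nil, fun y => by simp [eq_comm]⟩
  | succ n ih =>
    rintro b rfl
    obtain ⟨p, hp, hs⟩ := ih (by omega) (a + n) rfl
    have h : G.Adj (v (a + n)) (v (a + (n + 1 : ℕ))) := by
      have := hadj (a + n)
      rwa [add_assoc, ← Nat.cast_succ] at this
    refine ⟨p.concat h, ?_, fun y => ?_⟩
    · rw [Walk.concat_isPath_iff]
      refine ⟨hp, fun hmem => ?_⟩
      obtain ⟨k, hk, hkv⟩ := (hs _).1 hmem
      have h1 := add_left_cancel (hinj hkv)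
      rw [ZMod.natCast_eq_natCast_iff', Nat.mod_eq_of_lt (by omega), Nat.mod_eq_of_lt hn] at h1
      omega
    · simp only [Walk.support_concat, List.mem_append, List.mem_singleton, hs]
      constructor
      · rintro (⟨k, hk, h⟩ | rfl)
        · exact ⟨k, by omega, h⟩
        · exact ⟨n + 1, le_rfl, rfl⟩
      · rintro ⟨k, hk, h⟩
        rcases Nat.lt_or_ge n k with h' | h'
        · right
          obtain rfl : k = n + 1 := by omega
          exact h.symm
        · exact .inl ⟨k, h', h⟩

/-- A vertex adjacent to both ends of a nontrivial path and lying off it closes it to a cycle. -/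
theorem hasCycleOn_insert_of_isPath {V : Type*} {G : SimpleGraph V} {a b x : V}
    (p : G.Walk a b) (hp : p.IsPath) (hab : a ≠ b) (hx : x ∉ p.support)
    (hxa : G.Adj a x) (hxb : G.Adj b x) : HasCycleOn G (insert x {y | y ∈ p.support}) := by
  refine ⟨x, .cons hxa.symm (p.concat hxb), ?_, ?_⟩
  · rw [Walk.cons_isCycle_iff, Walk.concat_isPath_iff]
    refine ⟨⟨hp, hx⟩, fun hmem => ?_⟩
    rw [Walk.edges_concat, List.concat_eq_append, List.mem_append, List.mem_singleton] at hmem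
    rcases hmem with h | h
    · exact hx (p.fst_mem_support_of_mem_edges h)
    · rw [Sym2.eq_swap, Sym2.congr_left] at h
      exact hab h
  · ext y
    simp only [Walk.support_cons, Walk.support_concat, List.mem_cons,
      List.mem_append, List.not_mem_nil, or_false, Set.mem_ofPred_eq, Set.mem_insert_iff]
    tauto

/-- Two vertices of a cycle with a common neighbour off the cycle and adjacent successors allow
the cycle to be rerouted through that neighbour. -/
theorem hasCycleOn_insert_of_adj_succ {V : Type*} {G : SimpleGraph V} {t : ℕ} [NeZero t]
    {v : ZMod t → V} (hinj : Function.Injective v)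
    (hadj : ∀ z : ZMod t, G.Adj (v z) (v (z + 1))) {i j : ZMod t} (hij : i ≠ j) {x : V}
    (hx : x ∉ Set.range v) (hxi : G.Adj (v i) x) (hxj : G.Adj (v j) x)
    (h : G.Adj (v (i + 1)) (v (j + 1))) : HasCycleOn G (insert x (Set.range v)) := by
  obtain ⟨m, hm, hmj⟩ : ∃ m : ℕ, m < t ∧ (m : ZMod t) = j - i :=
    ⟨(j - i).val, ZMod.val_lt _, ZMod.natCast_zmod_val _⟩
  have hm0 : m ≠ 0 := by
    rintro rfl
    rw [Nat.cast_zero] at hmj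
    exact hij (sub_eq_zero.1 hmj.symm).symm
  obtain rfl : j = i + m := by rw [hmj]; ring
  obtain ⟨p, hp, hps⟩ := exists_isPath_arc hinj hadj (i + 1) (m - 1) (by omega) (i + m)
    (by rw [Nat.cast_sub (by omega)]; push_cast; ring)
  obtain ⟨q, hq, hqs⟩ := exists_isPath_arc hinj hadj (i + m + 1) (t - m - 1) (by omega) i
    (by
      rw [Nat.cast_sub (by omega), Nat.cast_sub (by omega), ZMod.natCast_self]
      push_cast; ring)
  have hdisj : ∀ y, y ∈ p.support → y ∉ q.support := by
    intro y hy hy'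
    obtain ⟨k, hk, rfl⟩ := (hps _).1 hy
    obtain ⟨l, hl, hkl⟩ := (hqs _).1 hy'
    have h1 := hinj hkl
    have h2 : ((m + l : ℕ) : ZMod t) = (k : ℕ) := by
      push_cast
      linear_combination h1
    rw [ZMod.natCast_eq_natCast_iff', Nat.mod_eq_of_lt (by omega),
      Nat.mod_eq_of_lt (by omega)] at h2
    omega
  have hr : (p.reverse.append (.cons h q)).IsPath := by
    rw [Walk.isPath_def, Walk.support_append, Walk.support_cons, List.tail_cons,
      Walk.support_reverse, List.nodup_append']
    refine ⟨List.nodup_reverse.2 hp.support_nodup, hq.support_nodup, fun y hy => ?_⟩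
    exact hdisj y (List.mem_reverse.1 hy)
  have hrs : {y | y ∈ (p.reverse.append (.cons h q)).support} = Set.range v := by
    ext y
    simp only [Walk.support_append, Walk.support_cons, List.tail_cons, Walk.support_reverse,
      Set.mem_ofPred_eq, List.mem_append, List.mem_reverse, hps, hqs]
    constructor
    · rintro (⟨k, -, rfl⟩ | ⟨k, -, rfl⟩) <;> exact Set.mem_range_self _
    · rintro ⟨z, rfl⟩
      obtain ⟨k, hk, hkz⟩ : ∃ k : ℕ, k < t ∧ (k : ZMod t) = z - (i + 1) :=
        ⟨(z - (i + 1)).val, ZMod.val_lt _, ZMod.natCast_zmod_val _⟩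
      rcases Nat.lt_or_ge k m with hkm | hkm
      · exact .inl ⟨k, by omega, by rw [hkz]; congr 1; ring⟩
      · refine .inr ⟨k - m, by omega, ?_⟩
        rw [Nat.cast_sub hkm, hkz]
        congr 1
        ring
  have hxr : x ∉ (p.reverse.append (.cons h q)).support := fun hmem => hx (hrs ▸ hmem)
  rw [← hrs]
  exact hasCycleOn_insert_of_isPath _ hr (fun e => hij (hinj e).symm) hxr hxj hxi

/-- Lemma 1(2): if `C = v 0, v 1, …, v (t-1), v 0` is a non-extendable cycle in `G`
and `v i`, `v j` are distinct attachment vertices with a common off-cycle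
neighbour `x`, then `v (i+1) ≁ v (j+1)` and `v (i-1) ≁ v (j-1)`. -/
theorem nonextendable_common_offcycle_neighbour_succ_pred_nonadj
    {V : Type*} (G : SimpleGraph V) (t : ℕ) (ht : 3 ≤ t)
    (v : ZMod t → V) (hinj : Function.Injective v)
    (hadj : ∀ z : ZMod t, G.Adj (v z) (v (z + 1)))
    (hnonext : ¬∃ x ∉ Set.range v, HasCycleOn G (insert x (Set.range v)))
    (i j : ZMod t) (hij : i ≠ j) (x : V) (hxoff : x ∉ Set.range v)
    (hxi : G.Adj (v i) x) (hxj : G.Adj (v j) x) :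
    ¬G.Adj (v (i + 1)) (v (j + 1)) ∧ ¬G.Adj (v (i - 1)) (v (j - 1)) := by
  have : NeZero t := ⟨by omega⟩
  refine ⟨fun h => hnonext ⟨x, hxoff,
    hasCycleOn_insert_of_adj_succ hinj hadj hij hxoff hxi hxj h⟩, fun h => hnonext ⟨x, hxoff, ?_⟩⟩
  have hrange : Set.range (fun z => v (-z)) = Set.range v := neg_surjective.range_comp v
  rw [← hrange]
  refine hasCycleOn_insert_of_adj_succ (v := fun z => v (-z)) (i := -i) (j := -j)
    (hinj.comp neg_injective) (fun z => ?_) (neg_injective.ne hij) (hrange ▸ hxoff) ?_ ?_ ?_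
  · have := (hadj (-(z + 1))).symm
    rwa [show -(z + 1) + 1 = -z by ring] at this
  · simpa only [neg_neg] using hxi
  · simpa only [neg_neg] using hxj
  · simpa only [neg_add', neg_neg] using h
end

section
/- Let G be a simple graph and let C = v_0 v_1 … v_{t-1} v_0 be a non-extendable cycle of length t in G (subscripts modulo t). Suppose v_i and v_j (i ≠ j) are two distinct attachment vertices of C that have a common off-cycle neighbour x. If v_{i-1} is adjacent to v_{i+1}, then v_{j-1} is not adjacent to v_i and v_{j+1} is not adjacent to v_i. -/
open SimpleGraph

theorem HasCycleOn.insert_of_isPath {V : Type*} {G : SimpleGraph V} {a b x : V}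
    {q : G.Walk a b} (hq : q.IsPath) (hab : a ≠ b) (hx : x ∉ q.support)
    (hxa : G.Adj x a) (hbx : G.Adj b x) :
    HasCycleOn G (insert x {y | y ∈ q.support}) := by
  refine ⟨x, Walk.cons hxa (q.concat hbx), ?_, ?_⟩
  · rw [Walk.cons_isCycle_iff]
    refine ⟨hq.concat hx hbx, ?_⟩
    rw [Walk.edges_concat, List.concat_eq_append, List.mem_append, List.mem_singleton]
    rintro (h | h)
    · exact hx (Walk.fst_mem_support_of_mem_edges _ h)
    · rw [Sym2.eq_swap, Sym2.eq_iff] at h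
      rcases h with ⟨h, -⟩ | ⟨-, h⟩
      · exact hab h
      · exact hx (h ▸ q.end_mem_support)
  · ext y
    simp only [Walk.support_cons, Walk.support_concat, List.mem_cons,
      List.mem_append, List.not_mem_nil, or_false, Set.mem_ofPred_eq, Set.mem_insert_iff]
    tauto

theorem SimpleGraph.exists_walk_support_eq_map_range {V : Type*} {G : SimpleGraph V}
    (w : ℕ → V) (n : ℕ) (h : ∀ k < n, G.Adj (w k) (w (k + 1))) :
    ∃ p : G.Walk (w 0) (w n), p.support = (List.range (n + 1)).map w := by
  induction n with
  | zero => exact ⟨Walk.nil, by simp⟩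
  | succ n ih =>
    obtain ⟨p, hp⟩ := ih fun k hk => h k (by omega)
    exact ⟨p.concat (h n (by omega)), by
      rw [Walk.support_concat, hp, List.range_succ (n := n + 1)]; simp⟩

/-- If `u m` can be bypassed on the path `u 0, …, u n`, then moving it to the end of the path
and closing up through `x` gives a cycle. -/
theorem HasCycleOn.of_bypass {V : Type*} {G : SimpleGraph V} {n m : ℕ} {u : ℕ → V} {x : V}
    (hinj : Set.InjOn u (Set.Iic n)) (hadj : ∀ k < n, G.Adj (u k) (u (k + 1)))
    (hm : 0 < m) (hmn : m < n) (hx : x ∉ u '' Set.Iic n)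
    (hbypass : G.Adj (u (m - 1)) (u (m + 1))) (hlast : G.Adj (u n) (u m))
    (hx0 : G.Adj x (u 0)) (hxm : G.Adj (u m) x) :
    HasCycleOn G (insert x (u '' Set.Iic n)) := by
  let σ : ℕ → ℕ := fun k => if k < m then k else if k < n then k + 1 else m
  have hσ : ∀ k ≤ n, σ k ≤ n := by grind
  have hσ0 : σ 0 = 0 := by grind
  have hσn : σ n = m := by grind
  have hσinj : Set.InjOn σ (Set.Iic n) := by
    intro a ha b hb h
    simp only [Set.mem_Iic] at ha hb
    grind
  have hσsurj : ∀ k ≤ n, ∃ l ≤ n, σ l = k := by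
    intro k hk
    rcases lt_trichotomy k m with h | h | h
    · exact ⟨k, hk, by grind⟩
    · exact ⟨n, le_rfl, by grind⟩
    · exact ⟨k - 1, by omega, by grind⟩
  obtain ⟨p, hp⟩ := exists_walk_support_eq_map_range (G := G) (u ∘ σ) n (by
    intro k hk
    simp only [Function.comp_apply]
    rcases lt_trichotomy (k + 1) m with h | h | h
    · rw [show σ k = k by grind, show σ (k + 1) = k + 1 by grind]
      exact hadj k hk
    · rw [show σ k = m - 1 by grind, show σ (k + 1) = m + 1 by grind]
      exact hbypass
    · rcases (show k + 1 ≤ n by omega).lt_or_eq with h' | h'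
      · rw [show σ k = k + 1 by grind, show σ (k + 1) = k + 1 + 1 by grind]
        exact hadj (k + 1) h'
      · rw [show σ k = n by grind, show σ (k + 1) = m by grind]
        exact hlast)
  have hsupp : {y | y ∈ p.support} = u '' Set.Iic n := by
    ext y
    simp only [hp, Set.mem_ofPred_eq, List.mem_map, List.mem_range, Function.comp_apply,
      Set.mem_image, Set.mem_Iic]
    constructor
    · rintro ⟨k, hk, rfl⟩
      exact ⟨σ k, hσ k (by omega), rfl⟩
    · rintro ⟨k, hk, rfl⟩
      obtain ⟨l, hl, rfl⟩ := hσsurj k hk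
      exact ⟨l, by omega, rfl⟩
  have hpath : p.IsPath := by
    rw [Walk.isPath_def, hp]
    refine List.Nodup.map_on ?_ List.nodup_range
    intro a ha b hb h
    rw [List.mem_range] at ha hb
    exact hσinj (by simp; omega) (by simp; omega)
      (hinj (hσ a (by omega)) (hσ b (by omega)) h)
  rw [← hsupp]
  refine insert_of_isPath hpath ?_ ?_ ?_ ?_
  · simp only [Function.comp_apply, hσ0, hσn]
    intro h
    have := hinj (by simp) (by simp; omega) h
    omega
  · rw [← hsupp] at hx
    exact hx
  · simpa [hσ0] using hx0
  · simpa [hσn] using hxm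

theorem HasCycleOn.insert_range_of_chord {V : Type*} {G : SimpleGraph V} {t : ℕ} (ht : 0 < t)
    {v : ZMod t → V} (hinj : Function.Injective v)
    (hadj : ∀ z : ZMod t, G.Adj (v z) (v (z + 1)))
    {i j : ZMod t} (hij : i ≠ j) {x : V} (hxoff : x ∉ Set.range v)
    (hxi : G.Adj (v i) x) (hxj : G.Adj (v j) x)
    (hchord : G.Adj (v (i - 1)) (v (i + 1))) (hji : G.Adj (v (j - 1)) (v i)) :
    HasCycleOn G (insert x (Set.range v)) := by
  have : NeZero t := ⟨ht.ne'⟩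
  have hcast : ((t - 1 : ℕ) : ZMod t) = -1 := by
    rw [Nat.cast_sub ht]; simp
  have hm : ((i - j).val : ZMod t) = i - j := ZMod.natCast_zmod_val _
  have hmlt : (i - j).val < t := ZMod.val_lt _
  have hm0 : 0 < (i - j).val := by
    rw [Nat.pos_iff_ne_zero, Ne, ZMod.val_eq_zero, sub_eq_zero]
    exact hij
  have hmne : (i - j).val ≠ t - 1 := by
    intro h
    rw [h, hcast] at hm
    rw [show j - 1 = i by linear_combination hm] at hji
    exact hji.ne rfl
  have hrange : (fun k : ℕ => v (j + k)) '' Set.Iic (t - 1) = Set.range v := by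
    ext y
    constructor
    · rintro ⟨k, -, rfl⟩
      exact ⟨_, rfl⟩
    · rintro ⟨z, rfl⟩
      exact ⟨(z - j).val, Nat.le_sub_one_of_lt (ZMod.val_lt _), by simp⟩
  rw [← hrange]
  refine of_bypass (m := (i - j).val) ?_ ?_ hm0 (by omega) (hrange ▸ hxoff) ?_ ?_ ?_ ?_
  · intro a ha b hb h
    simp only [Set.mem_Iic] at ha hb
    have h' := congrArg ZMod.val (add_left_cancel (hinj h))
    rwa [ZMod.val_cast_of_lt (by omega), ZMod.val_cast_of_lt (by omega)] at h'
  · intro k _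
    simpa [add_assoc] using hadj (j + k)
  · convert hchord using 2
    · rw [Nat.cast_sub hm0, hm]; push_cast; ring
    · push_cast; rw [hm]; ring
  · simpa [hcast, ← sub_eq_add_neg] using hji
  · simpa using hxj.symm
  · simpa using hxi

/-- Lemma 1(3): if `C = v 0, v 1, …, v (t-1), v 0` is a non-extendable cycle in `G`,
`v i`, `v j` are distinct attachment vertices with a common off-cycle neighbour `x`,
and `v (i-1) ~ v (i+1)`, then `v (j-1) ≁ v i` and `v (j+1) ≁ v i`. -/
theorem nonextendable_common_offcycle_neighbour_chord_nonadj
    {V : Type*} (G : SimpleGraph V) (t : ℕ) (ht : 3 ≤ t)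
    (v : ZMod t → V) (hinj : Function.Injective v)
    (hadj : ∀ z : ZMod t, G.Adj (v z) (v (z + 1)))
    (hnonext : ¬∃ x ∉ Set.range v, HasCycleOn G (insert x (Set.range v)))
    (i j : ZMod t) (hij : i ≠ j) (x : V) (hxoff : x ∉ Set.range v)
    (hxi : G.Adj (v i) x) (hxj : G.Adj (v j) x)
    (hchord : G.Adj (v (i - 1)) (v (i + 1))) :
    ¬G.Adj (v (j - 1)) (v i) ∧ ¬G.Adj (v (j + 1)) (v i) := by
  have ht0 : 0 < t := by omega
  refine ⟨fun h => hnonext ⟨x, hxoff,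
    .insert_range_of_chord ht0 hinj hadj hij hxoff hxi hxj hchord h⟩, fun h => ?_⟩
  have hrange : Set.range (fun z => v (-z)) = Set.range v :=
    (Equiv.neg _).surjective.range_comp v
  refine hnonext ⟨x, hxoff, hrange ▸ HasCycleOn.insert_range_of_chord
    (v := fun z => v (-z)) (i := -i) (j := -j) ht0 (hinj.comp neg_injective)
    (fun z => ?_) (neg_injective.ne hij) (hrange ▸ hxoff)
    (by simpa using hxi) (by simpa using hxj) ?_ ?_⟩
  · convert (hadj (-(z + 1))).symm using 2
    ring
  · convert hchord.symm using 2 <;> ring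
  · convert h using 2 <;> ring
end

section
/- Let G be a locally isometric graph with maximum degree Δ(G) = 6 and let C = v_0 v_1 … v_{t-1} v_0 be a non-extendable cycle of length t in G (subscripts modulo t). Suppose v_0 has exactly one off-cycle neighbour x and that N(v_0) = {v_1, v_i, v_j, v_k, v_{t-1}, x} where 1 < i < j < k < t-1. If v_k is adjacent to all of x, v_1 and v_{t-1}, then k + 1 = t - 1. Similarly, if v_i is adjacent to all of x, v_1 and v_{t-1}, then i = 2. -/
open SimpleGraph

/-- `G` is locally isometric: the subgraph induced by every open neighbourhood
has diameter at most `2`. -/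
def LocallyIsometric {V : Type*} (G : SimpleGraph V) : Prop :=
  ∀ v : V, (G.induce (G.neighborSet v)).ediam ≤ 2

/-- The walk `f 0, f 1, …, f n` along a sequence of successively adjacent vertices. -/
def walkAlong {V : Type*} {G : SimpleGraph V} (f : ℕ → V) (hf : ∀ n, G.Adj (f n) (f (n + 1))) :
    (n : ℕ) → G.Walk (f 0) (f n)
  | 0 => .nil
  | n + 1 => (walkAlong f hf n).concat (hf n)

theorem support_walkAlong {V : Type*} {G : SimpleGraph V} (f : ℕ → V)
    (hf : ∀ n, G.Adj (f n) (f (n + 1))) (n : ℕ) :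
    (walkAlong f hf n).support = (List.range (n + 1)).map f := by
  induction n with
  | zero => simp [walkAlong]
  | succ n ih =>
    rw [walkAlong, Walk.support_concat, ih, List.range_succ (n := n + 1)]
    simp

theorem isPath_walkAlong {V : Type*} {G : SimpleGraph V} (f : ℕ → V)
    (hf : ∀ n, G.Adj (f n) (f (n + 1))) (n : ℕ) (hinj : Set.InjOn f (Set.Iic n)) :
    (walkAlong f hf n).IsPath := by
  rw [Walk.isPath_def, support_walkAlong]
  refine List.Nodup.map_on (fun a ha b hb h => hinj ?_ ?_ h) List.nodup_range <;>
    simp only [List.mem_range, Set.mem_Iic] at * <;> omega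

theorem ZMod.injOn_natCast (t : ℕ) : Set.InjOn (fun n : ℕ => (n : ZMod t)) (Set.Iio t) := by
  intro a ha b hb h
  simpa [ZMod.natCast_eq_natCast_iff', Nat.mod_eq_of_lt ha, Nat.mod_eq_of_lt hb] using h

/-- A path together with a new vertex adjacent to both of its distinct ends yields a cycle. -/
theorem HasCycleOn.of_isPath {V : Type*} {G : SimpleGraph V} {a b x : V} (p : G.Walk a b)
    (hp : p.IsPath) (hab : a ≠ b) (hx : x ∉ p.support) (ha : G.Adj x a) (hb : G.Adj x b) :
    HasCycleOn G (insert x {y | y ∈ p.support}) := by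
  refine ⟨x, .cons ha (p.concat hb.symm), ?_, ?_⟩
  · rw [Walk.cons_isCycle_iff]
    refine ⟨hp.concat hx hb.symm, fun h => ?_⟩
    rw [Walk.edges_concat, List.concat_eq_append, List.mem_append, List.mem_singleton] at h
    rcases h with h | h
    · exact hx (p.fst_mem_support_of_mem_edges h)
    · rw [Sym2.eq_swap, Sym2.congr_left] at h
      exact hab h
  · ext y
    simp [Walk.support_concat]
    tauto

/-- A vertex off a cycle and adjacent to two consecutive cycle vertices extends the cycle. -/
theorem hasCycleOn_insert_of_adj_consecutive {V : Type*} {G : SimpleGraph V} {t : ℕ} (ht : t ≠ 0)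
    {v : ZMod t → V} (hinj : Function.Injective v) (hadj : ∀ z, G.Adj (v z) (v (z + 1)))
    {x : V} (hx : x ∉ Set.range v) {z : ZMod t} (h₀ : G.Adj x (v z)) (h₁ : G.Adj x (v (z + 1))) :
    HasCycleOn G (insert x (Set.range v)) := by
  have : NeZero t := ⟨ht⟩
  let f : ℕ → V := fun n => v (z + 1 + n)
  have hf : ∀ n, G.Adj (f n) (f (n + 1)) := fun n => by
    have := hadj (z + 1 + n)
    simpa [f, add_assoc] using this
  have hinjf : Set.InjOn f (Set.Iic (t - 1)) := by
    intro a ha b hb h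
    simp only [Set.mem_Iic] at ha hb
    exact ZMod.injOn_natCast t (by simp; omega) (by simp; omega) (add_left_cancel (hinj h))
  have hfirst : f 0 = v (z + 1) := by simp [f]
  have hlast : f (t - 1) = v z := by
    simp [f, Nat.cast_sub (Nat.one_le_iff_ne_zero.mpr ht)]
  have hsupp : {y | y ∈ (walkAlong f hf (t - 1)).support} = Set.range v := by
    ext y
    simp only [support_walkAlong, Set.mem_ofPred_eq, List.mem_map, List.mem_range, Set.mem_range]
    constructor
    · rintro ⟨n, -, rfl⟩
      exact ⟨_, rfl⟩
    · rintro ⟨w, rfl⟩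
      refine ⟨(w - (z + 1)).val, ?_, ?_⟩
      · have := ZMod.val_lt (w - (z + 1))
        omega
      · simp [f]
  rw [← hsupp]
  refine HasCycleOn.of_isPath _ (isPath_walkAlong f hf _ hinjf) ?_ ?_ ?_ ?_
  · rw [hfirst, hlast]
    exact (hadj z).ne'
  · rw [← hsupp] at hx
    exact hx
  · rwa [hfirst]
  · rwa [hlast]

theorem adj_or_exists_adj_adj_of_edist_le_two {V : Type*} {G : SimpleGraph V} {a b : V}
    (hne : a ≠ b) (h : G.edist a b ≤ 2) : G.Adj a b ∨ ∃ c, G.Adj a c ∧ G.Adj c b := by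
  obtain ⟨p, hp⟩ := exists_walk_of_edist_ne_top (ne_top_of_le_ne_top (by decide) h)
  rw [← hp] at h
  have hlen : p.length ≤ 2 := by exact_mod_cast h
  match p, hlen with
  | .nil, _ => exact absurd rfl hne
  | .cons h₁ .nil, _ => exact .inl h₁
  | .cons h₁ (.cons h₂ .nil), _ => exact .inr ⟨_, h₁, h₂⟩
  | .cons _ (.cons _ (.cons _ _)), h => simp at h

theorem LocallyIsometric.adj_or_exists {V : Type*} {G : SimpleGraph V} (hG : LocallyIsometric G)
    {w a b : V} (ha : G.Adj w a) (hb : G.Adj w b) (hne : a ≠ b) :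
    G.Adj a b ∨ ∃ c, G.Adj w c ∧ G.Adj a c ∧ G.Adj c b := by
  have h := adj_or_exists_adj_adj_of_edist_le_two
    (G := G.induce (G.neighborSet w)) (a := ⟨a, ha⟩) (b := ⟨b, hb⟩)
    (fun h => hne (congrArg Subtype.val h)) (edist_le_ediam.trans (hG w))
  rcases h with h | ⟨⟨c, hc⟩, h₁, h₂⟩
  · exact .inl h
  · exact .inr ⟨c, hc, h₁, h₂⟩

/-- If a cycle vertex `v m` is adjacent to `v 0`, to both cycle neighbours of `v 0` and to an
off-cycle neighbour `x` of `v 0`, and these are not cycle neighbours of `v m`, then `v 0` is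
adjacent to both cycle neighbours of `v m`: it is the only neighbour of `x` in `N(v m)`. -/
theorem adj_cycle_neighbors_of_adj_three {V : Type*} [Fintype V] {G : SimpleGraph V}
    [DecidableRel G.Adj] (hli : LocallyIsometric G) (hmax : G.maxDegree ≤ 6)
    {t : ℕ} {v : ZMod t → V} (hinj : Function.Injective v)
    (hadj : ∀ z : ZMod t, G.Adj (v z) (v (z + 1)))
    (hnonext : ¬∃ y ∉ Set.range v, HasCycleOn G (insert y (Set.range v)))
    {x : V} (hxoff : x ∉ Set.range v) (hx₀ : G.Adj (v 0) x)
    {m : ℕ} (hm : 2 < m) (hmt : m + 2 < t) (hm₀ : G.Adj (v m) (v 0)) (hmx : G.Adj (v m) x)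
    (hm₁ : G.Adj (v m) (v 1)) (hml : G.Adj (v m) (v (t - 1 : ℕ))) :
    G.Adj (v 0) (v (m - 1 : ℕ)) ∧ G.Adj (v 0) (v (m + 1 : ℕ)) := by
  classical
  have hne : ∀ a b : ℕ, a < t → b < t → a ≠ b → v a ≠ v b := fun a b ha hb hab h =>
    hab (ZMod.injOn_natCast t ha hb (hinj h))
  have hx : ∀ z, x ≠ v z := fun z h => hxoff ⟨z, h.symm⟩
  have hcons : ∀ z, G.Adj x (v z) → ¬G.Adj x (v (z + 1)) := fun z h₀ h₁ => hnonext
    ⟨x, hxoff, hasCycleOn_insert_of_adj_consecutive (by omega) hinj hadj hxoff h₀ h₁⟩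
  have hpred : ((m - 1 : ℕ) : ZMod t) + 1 = m := by
    rw [Nat.cast_sub (by omega)]
    simp
  have hlast : ((t - 1 : ℕ) : ZMod t) + 1 = 0 := by
    rw [Nat.cast_sub (by omega)]
    simp
  have hmp : G.Adj (v m) (v (m - 1 : ℕ)) := by
    simpa only [hpred] using (hadj (m - 1 : ℕ)).symm
  have hms : G.Adj (v m) (v (m + 1 : ℕ)) := by
    simpa only [Nat.cast_add, Nat.cast_one] using hadj m
  have hxm : ¬G.Adj x (v (m - 1 : ℕ)) := fun h =>
    hcons _ h (hpred ▸ hmx.symm)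
  have hxs : ¬G.Adj x (v (m + 1 : ℕ)) := by
    simpa only [Nat.cast_add, Nat.cast_one] using hcons m hmx.symm
  have hx1 : ¬G.Adj x (v 1) := by simpa only [zero_add] using hcons 0 hx₀.symm
  have hxl : ¬G.Adj x (v (t - 1 : ℕ)) := fun h => hcons _ h (hlast ▸ hx₀.symm)
  let S : Finset V :=
    {x, v (0 : ℕ), v (1 : ℕ), v (t - 1 : ℕ), v (m - 1 : ℕ), v (m + 1 : ℕ)}
  have hcard : S.card = 6 := by
    simp only [S]
    repeat rw [Finset.card_insert_of_notMem]
    · simp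
    all_goals
      simp only [Finset.mem_insert, Finset.mem_singleton, not_or]
      (repeat' apply And.intro) <;> first | exact hx _ | (apply hne <;> omega)
  have hsub : S ⊆ G.neighborFinset (v m) := by
    intro y hy
    simp only [S, Finset.mem_insert, Finset.mem_singleton, Nat.cast_zero, Nat.cast_one] at hy
    rw [mem_neighborFinset]
    rcases hy with rfl | rfl | rfl | rfl | rfl | rfl <;> assumption
  have hS : S = G.neighborFinset (v m) := Finset.eq_of_subset_of_card_le hsub <| by
    rw [hcard]
    exact (G.degree_le_maxDegree _).trans hmax
  have honly : ∀ c, G.Adj (v m) c → G.Adj x c → c = v 0 := by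
    intro c hc hxc
    rw [← mem_neighborFinset, ← hS] at hc
    simp only [S, Finset.mem_insert, Finset.mem_singleton, Nat.cast_zero, Nat.cast_one] at hc
    rcases hc with rfl | rfl | rfl | rfl | rfl | rfl
    · exact absurd hxc (G.irrefl)
    · rfl
    all_goals contradiction
  have key : ∀ z, G.Adj (v m) (v z) → ¬G.Adj x (v z) → G.Adj (v 0) (v z) := by
    intro z hz hxz
    obtain h | ⟨c, hc, hxc, hcz⟩ := hli.adj_or_exists hmx hz (hx z)
    · exact absurd h hxz
    · exact honly c hc hxc ▸ hcz
  exact ⟨key _ hmp hxm, key _ hms hxs⟩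

/-- Lemma 2(1): let `G` be locally isometric with maximum degree `6`, let
`C = v 0, …, v (t-1), v 0` be a non-extendable cycle, and suppose `v 0` has exactly
one off-cycle neighbour `x` with `N(v 0) = {v 1, v i, v j, v k, v (t-1), x}` where
`1 < i < j < k < t - 1`.  If `v k ~ x, v 1, v (t-1)`, then `k + 1 = t - 1`;
similarly, if `v i ~ x, v 1, v (t-1)`, then `i = 2`. -/
theorem nonextendable_adj_all_three_endpoints
    {V : Type*} [Fintype V] (G : SimpleGraph V) [DecidableRel G.Adj]
    (hli : LocallyIsometric G) (hmax : G.maxDegree = 6)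
    (t : ℕ) (ht : 3 ≤ t) (v : ZMod t → V) (hinj : Function.Injective v)
    (hadj : ∀ z : ZMod t, G.Adj (v z) (v (z + 1)))
    (hnonext : ¬∃ y ∉ Set.range v, HasCycleOn G (insert y (Set.range v)))
    (x : V) (hxoff : x ∉ Set.range v)
    (i j k : ℕ) (h1i : 1 < i) (hij : i < j) (hjk : j < k) (hkt : k < t - 1)
    (hN : G.neighborSet (v 0) =
      {v 1, v (i : ZMod t), v (j : ZMod t), v (k : ZMod t), v ((t - 1 : ℕ) : ZMod t), x})
    (hunique : ∀ y : V, G.Adj (v 0) y → y ∉ Set.range v → y = x) :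
    (G.Adj (v (k : ZMod t)) x ∧ G.Adj (v (k : ZMod t)) (v 1) ∧
        G.Adj (v (k : ZMod t)) (v ((t - 1 : ℕ) : ZMod t)) → k + 1 = t - 1) ∧
    (G.Adj (v (i : ZMod t)) x ∧ G.Adj (v (i : ZMod t)) (v 1) ∧
        G.Adj (v (i : ZMod t)) (v ((t - 1 : ℕ) : ZMod t)) → i = 2) := by
  have hne : ∀ a b : ℕ, a < t → b < t → a ≠ b → v a ≠ v b := fun a b ha hb hab h =>
    hab (ZMod.injOn_natCast t ha hb (hinj h))
  have hnbr : ∀ y, G.Adj (v 0) y ↔ y ∈ ({v (1 : ℕ), v (i : ZMod t), v (j : ZMod t),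
      v (k : ZMod t), v ((t - 1 : ℕ) : ZMod t), x} : Set V) := by
    rw [Nat.cast_one, ← hN]
    exact fun _ => Iff.rfl
  have hx : ∀ z, v z ≠ x := fun z h => hxoff ⟨z, h⟩
  have hx₀ : G.Adj (v 0) x := by simp [hnbr]
  refine ⟨fun ⟨hkx, hk₁, hkl⟩ => ?_, fun ⟨hix, hi₁, hil⟩ => ?_⟩
  · by_contra hk
    have h := (adj_cycle_neighbors_of_adj_three hli hmax.le hinj hadj hnonext hxoff hx₀
      (m := k) (by omega) (by omega) (G.adj_symm (by simp [hnbr])) hkx hk₁ hkl).2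
    rw [hnbr] at h
    simp only [Set.mem_insert_iff, Set.mem_singleton_iff, hx, or_false] at h
    rcases h with h | h | h | h | h <;> revert h <;> apply hne <;> omega
  · by_contra hi
    have h := (adj_cycle_neighbors_of_adj_three hli hmax.le hinj hadj hnonext hxoff hx₀
      (m := i) (by omega) (by omega) (G.adj_symm (by simp [hnbr])) hix hi₁ hil).1
    rw [hnbr] at h
    simp only [Set.mem_insert_iff, Set.mem_singleton_iff, hx, or_false] at h
    rcases h with h | h | h | h | h <;> revert h <;> apply hne <;> omega
end

section
/- Let G be a locally isometric graph with maximum degree Δ(G) = 6 and let C = v_0 v_1 … v_{t-1} v_0 be a non-extendable cycle of length t in G (subscripts modulo t). Suppose v_0 has exactly one off-cycle neighbour x and that N(v_0) = {v_1, v_i, v_j, v_k, v_{t-1}, x} where 1 < i < j < k < t-1. If v_j is adjacent to all of x, v_1 and v_{t-1}, then v_0 and v_j are true twins and deg(v_0) = deg(v_j) = 6. -/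
open SimpleGraph

theorem LocallyIsometric.exists_common_neighbor {V : Type*} {G : SimpleGraph V}
    (h : LocallyIsometric G) {u a b : V} (ha : G.Adj u a) (hb : G.Adj u b) (hne : a ≠ b)
    (hab : ¬G.Adj a b) : ∃ w, G.Adj u w ∧ G.Adj a w ∧ G.Adj b w := by
  let H := G.induce (G.neighborSet u)
  let a' : G.neighborSet u := ⟨a, ha⟩
  let b' : G.neighborSet u := ⟨b, hb⟩
  have hne' : a' ≠ b' := fun e => hne (congrArg Subtype.val e)
  have hab' : ¬H.Adj a' b' := hab
  have hle : H.edist a' b' ≤ 2 := edist_le_ediam.trans (h u)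
  have hpos : 0 < H.edist a' b' := edist_pos_of_ne hne'
  have hone : H.edist a' b' ≠ 1 := fun e => hab' (edist_eq_one_iff_adj.mp e)
  have htwo : H.edist a' b' = 2 := by
    generalize H.edist a' b' = d at *
    lift d to ℕ using ne_top_of_le_ne_top (by decide) hle
    norm_cast at *
    lia
  obtain ⟨-, -, w, hw⟩ := edist_eq_two_iff.mp htwo
  exact ⟨w, w.2, hw.1, hw.2⟩

theorem exists_walk_add_natCast {V : Type*} {G : SimpleGraph V} {t : ℕ} {v : ZMod t → V}
    (hadj : ∀ z : ZMod t, G.Adj (v z) (v (z + 1))) (z : ZMod t) (n : ℕ) :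
    ∃ p : G.Walk (v z) (v (z + n)),
      p.support = (List.range (n + 1)).map fun m : ℕ => v (z + m) := by
  induction n with
  | zero => exact ⟨Walk.nil.copy rfl (by simp), by simp⟩
  | succ n ih =>
    obtain ⟨p, hp⟩ := ih
    have hstep : v (z + n + 1) = v (z + (n + 1 : ℕ)) := by push_cast; ring_nf
    refine ⟨(p.concat (hadj (z + n))).copy rfl hstep, ?_⟩
    rw [Walk.support_copy, Walk.support_concat, hp, List.range_succ (n := n + 1), List.map_append,
      hstep]
    rfl

theorem natCast_injOn_Iio (t : ℕ) : Set.InjOn (Nat.cast : ℕ → ZMod t) (Set.Iio t) := by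
  intro a ha b hb hab
  have := (ZMod.natCast_eq_natCast_iff' a b t).mp hab
  rwa [Nat.mod_eq_of_lt ha, Nat.mod_eq_of_lt hb] at this

/-- A vertex off a cycle that is adjacent to two consecutive vertices of the cycle can be inserted
between them. -/
theorem hasCycleOn_insert_range {V : Type*} {G : SimpleGraph V} {t : ℕ} (ht : 2 ≤ t)
    {v : ZMod t → V} (hinj : Function.Injective v)
    (hadj : ∀ z : ZMod t, G.Adj (v z) (v (z + 1))) {x : V} (hx : x ∉ Set.range v) {z : ZMod t}
    (h₁ : G.Adj x (v z)) (h₂ : G.Adj x (v (z + 1))) :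
    HasCycleOn G (insert x (Set.range v)) := by
  have : NeZero t := ⟨by lia⟩
  have : Fact (1 < t) := ⟨ht⟩
  obtain ⟨p, hp⟩ := exists_walk_add_natCast hadj (z + 1) (t - 1)
  have hend : v (z + 1 + (t - 1 : ℕ)) = v z := by
    rw [Nat.cast_sub (by lia)]; simp
  rw [Nat.sub_add_cancel (by lia)] at hp
  have hpath : p.IsPath := by
    rw [Walk.isPath_def, hp]
    refine List.Nodup.map_on (fun a ha b hb hab => ?_) List.nodup_range
    exact natCast_injOn_Iio t (List.mem_range.mp ha) (List.mem_range.mp hb)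
      (add_left_cancel (hinj hab))
  have hmem : ∀ y, y ∈ p.support ↔ y ∈ Set.range v := by
    intro y
    simp only [hp, List.mem_map, List.mem_range, Set.mem_range]
    constructor
    · rintro ⟨m, -, rfl⟩
      exact ⟨_, rfl⟩
    · rintro ⟨y, rfl⟩
      exact ⟨(y - (z + 1)).val, ZMod.val_lt _, by simp⟩
  have hxp : x ∉ p.support := fun h => hx ((hmem x).mp h)
  have hlast : G.Adj (v (z + 1 + (t - 1 : ℕ))) x := by rw [hend]; exact h₁.symm
  refine ⟨x, Walk.cons h₂ (p.concat hlast), ?_, ?_⟩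
  · refine (Walk.cons_isCycle_iff _ _).mpr ⟨hpath.concat hxp hlast, fun hmem_edge => ?_⟩
    rw [Walk.edges_concat, List.concat_eq_append, List.mem_append, List.mem_singleton] at hmem_edge
    rcases hmem_edge with he | he
    · exact hxp (p.fst_mem_support_of_mem_edges he)
    · rw [hend, Sym2.eq_swap, Sym2.congr_left] at he
      simpa using hinj he
  · ext y
    simp [Walk.support_concat, hmem]
    tauto

/-- Lemma 2(2): let `G` be locally isometric with maximum degree `6`, let
`C = v 0, …, v (t-1), v 0` be a non-extendable cycle, and suppose `v 0` has exactly
one off-cycle neighbour `x` with `N(v 0) = {v 1, v i, v j, v k, v (t-1), x}` where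
`1 < i < j < k < t - 1`.  If `v j ~ x, v 1, v (t-1)`, then `v 0` and `v j` are true
twins (equal closed neighbourhoods) of degree `6`. -/
theorem nonextendable_adj_all_three_middle_true_twins
    {V : Type*} [Fintype V] (G : SimpleGraph V) [DecidableRel G.Adj]
    (hli : LocallyIsometric G) (hmax : G.maxDegree = 6)
    (t : ℕ) (ht : 3 ≤ t) (v : ZMod t → V) (hinj : Function.Injective v)
    (hadj : ∀ z : ZMod t, G.Adj (v z) (v (z + 1)))
    (hnonext : ¬∃ y ∉ Set.range v, HasCycleOn G (insert y (Set.range v)))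
    (x : V) (hxoff : x ∉ Set.range v)
    (i j k : ℕ) (h1i : 1 < i) (hij : i < j) (hjk : j < k) (hkt : k < t - 1)
    (hN : G.neighborSet (v 0) =
      {v 1, v (i : ZMod t), v (j : ZMod t), v (k : ZMod t), v ((t - 1 : ℕ) : ZMod t), x})
    (hunique : ∀ y : V, G.Adj (v 0) y → y ∉ Set.range v → y = x)
    (hvj : G.Adj (v (j : ZMod t)) x ∧ G.Adj (v (j : ZMod t)) (v 1) ∧
      G.Adj (v (j : ZMod t)) (v ((t - 1 : ℕ) : ZMod t))) :
    insert (v 0) (G.neighborSet (v 0)) =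
      insert (v (j : ZMod t)) (G.neighborSet (v (j : ZMod t))) ∧
    G.degree (v 0) = 6 ∧ G.degree (v (j : ZMod t)) = 6 := by
  classical
  obtain ⟨w, hw⟩ : ∃ w : ℕ → V, ∀ n : ℕ, v (n : ZMod t) = w n := ⟨_, fun _ => rfl⟩
  have hw0 : v 0 = w 0 := by rw [← hw, Nat.cast_zero]
  have hw1 : v 1 = w 1 := by rw [← hw, Nat.cast_one]
  have hwsucc : ∀ n : ℕ, v ((n : ZMod t) + 1) = w (n + 1) := fun n => by rw [← hw]; push_cast; rfl
  have hwt : w t = w 0 := by rw [← hw, ← hw]; simp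
  have hwinj : ∀ a b : ℕ, a < t → b < t → w a = w b → a = b := fun a b ha hb h =>
    natCast_injOn_Iio t ha hb (hinj (by rwa [hw, hw]))
  have hwadj : ∀ n : ℕ, G.Adj (w n) (w (n + 1)) := fun n => by
    rw [← hwsucc, ← hw]; exact hadj n
  have hwins : ∀ n : ℕ, G.Adj x (w n) → ¬G.Adj x (w (n + 1)) := fun n h₁ h₂ =>
    hnonext ⟨x, hxoff, hasCycleOn_insert_range (by lia) hinj hadj hxoff
      (z := (n : ZMod t)) (by rwa [hw]) (by rwa [hwsucc])⟩
  have hxw : ∀ n : ℕ, x ≠ w n := fun n h => hxoff ⟨n, by rw [hw, h]⟩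
  simp only [hw, hw0, hw1] at hN hvj ⊢
  obtain ⟨hjx, hj1, hjt⟩ := hvj
  have hmem0 : ∀ y, G.Adj (w 0) y ↔
      y = w 1 ∨ y = w i ∨ y = w j ∨ y = w k ∨ y = w (t - 1) ∨ y = x := fun y => by
    rw [← mem_neighborSet, hN]; simp
  have h0x : G.Adj (w 0) x := (hmem0 x).mpr (by simp)
  have h0j : G.Adj (w 0) (w j) := (hmem0 _).mpr (by simp)
  have hpred : G.Adj (w (j - 1)) (w j) := by
    simpa [Nat.sub_add_cancel (show 1 ≤ j by lia)] using hwadj (j - 1)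
  have hx1 : ¬G.Adj x (w 1) := hwins 0 h0x.symm
  have hxlast : ¬G.Adj x (w (t - 1)) := fun h => hwins (t - 1) h <| by
    rw [Nat.sub_add_cancel (by lia), hwt]; exact h0x.symm
  have hxpred : ¬G.Adj x (w (j - 1)) := fun h => hwins (j - 1) h <| by
    rw [Nat.sub_add_cancel (by lia)]; exact hjx.symm
  have hxsucc : ¬G.Adj x (w (j + 1)) := hwins j hjx.symm
  have hcard : ∀ a b c d e : ℕ, [a, b, c, d, e].Nodup →
      (∀ n ∈ [a, b, c, d, e], n < t) →
      ({w a, w b, w c, w d, w e, x} : Finset V).card = 6 := by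
    intro a b c d e hnd hlt
    have hne : ∀ m n, m < t → n < t → m ≠ n → w m ≠ w n := fun m n hm hn h h' =>
      h (hwinj m n hm hn h')
    simp only [List.nodup_cons, List.mem_cons, List.not_mem_nil, or_false, not_or, forall_eq_or_imp,
      forall_eq] at hnd hlt
    obtain ⟨⟨_, _, _, _⟩, ⟨_, _, _⟩, ⟨_, _⟩, _, _⟩ := hnd
    obtain ⟨_, _, _, _, _⟩ := hlt
    have hxw' : ∀ n, w n ≠ x := fun n => (hxw n).symm
    repeat rw [Finset.card_insert_of_notMem (by simp [*])]
    simp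
  have hNj : G.neighborFinset (w j) = {w 0, w 1, w (j - 1), w (j + 1), w (t - 1), x} := by
    symm
    apply Finset.eq_of_subset_of_card_le
    · intro y hy
      simp only [Finset.mem_insert, Finset.mem_singleton] at hy
      rw [mem_neighborFinset]
      rcases hy with rfl | rfl | rfl | rfl | rfl | rfl
      exacts [h0j.symm, hj1, hpred.symm, hwadj j, hjt, hjx]
    · rw [card_neighborFinset_eq_degree, hcard _ _ _ _ _ (by simp; lia) (by simp; lia)]
      exact hmax ▸ G.degree_le_maxDegree _
  have hmemj : ∀ y, G.Adj (w j) y ↔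
      y = w 0 ∨ y = w 1 ∨ y = w (j - 1) ∨ y = w (j + 1) ∨ y = w (t - 1) ∨ y = x := fun y => by
    rw [← mem_neighborFinset, hNj]; simp
  have hzero : ∀ y, G.Adj (w j) y → y ≠ x → ¬G.Adj x y → G.Adj (w 0) y := by
    intro y hjy hyx hxy
    obtain ⟨u, hju, hxu, hyu⟩ := hli.exists_common_neighbor hjx hjy hyx.symm hxy
    rcases (hmemj u).mp hju with rfl | rfl | rfl | rfl | rfl | rfl
    exacts [hyu.symm, (hx1 hxu).elim, (hxpred hxu).elim, (hxsucc hxu).elim, (hxlast hxu).elim,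
      (G.irrefl hxu).elim]
  have hidx : ∀ n, n < t → n ≠ 1 → n ≠ j → n ≠ t - 1 → G.Adj (w 0) (w n) → n = i ∨ n = k := by
    intro n hn hn1 hnj hnt h
    rcases (hmem0 _).mp h with h | h | h | h | h | h
    · exact (hn1 (hwinj _ _ hn (by lia) h)).elim
    · exact .inl (hwinj _ _ hn (by lia) h)
    · exact (hnj (hwinj _ _ hn (by lia) h)).elim
    · exact .inr (hwinj _ _ hn (by lia) h)
    · exact (hnt (hwinj _ _ hn (by lia) h)).elim
    · exact (hxw n h.symm).elim
  have hi : j - 1 = i := by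
    have := hidx (j - 1) (by lia) (by lia) (by lia) (by lia)
      (hzero _ hpred.symm (hxw _).symm hxpred)
    lia
  have hk : j + 1 = k := by
    have := hidx (j + 1) (by lia) (by lia) (by lia) (by lia)
      (hzero _ (hwadj j) (hxw _).symm hxsucc)
    lia
  refine ⟨?_, ?_, ?_⟩
  · ext y
    simp only [Set.mem_insert_iff, mem_neighborSet, hmem0, hmemj, hi, hk]
    tauto
  · have hN0 : G.neighborFinset (w 0) = {w 1, w i, w j, w k, w (t - 1), x} := by
      ext y
      simp [hmem0]
    rw [hw0, ← card_neighborFinset_eq_degree, hN0]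
    exact hcard _ _ _ _ _ (by simp; lia) (by simp; lia)
  · rw [hw, ← card_neighborFinset_eq_degree, hNj]
    exact hcard _ _ _ _ _ (by simp; lia) (by simp; lia)
end

section
/- Let G be a locally isometric graph of order n ≥ 3 with no pair of true twins of degree Δ(G). Suppose x and v are vertices of G such that x ∈ N(v) and deg(v) = Δ(G). Then there exist two distinct vertices y, z ∈ N(v) \ {x} such that x is adjacent to both y and z. -/
open SimpleGraph

/-- In a locally isometric graph, two distinct neighbours of a vertex are adjacent or
have a common neighbour inside the neighbourhood. -/
theorem LocallyIsometric.adj_or_exists_common {V : Type*} {G : SimpleGraph V}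
    (h : LocallyIsometric G) {v a b : V} (ha : G.Adj v a) (hb : G.Adj v b) (hab : a ≠ b) :
    G.Adj a b ∨ ∃ c, G.Adj v c ∧ G.Adj a c ∧ G.Adj c b := by
  have hd : (G.induce (G.neighborSet v)).edist ⟨a, ha⟩ ⟨b, hb⟩ ≤ 2 := edist_le_ediam.trans (h v)
  have hne : (G.induce (G.neighborSet v)).edist ⟨a, ha⟩ ⟨b, hb⟩ ≠ ⊤ :=
    ne_top_of_le_ne_top (by decide) hd
  obtain ⟨p, hp⟩ := exists_walk_of_edist_ne_top hne
  rw [← hp] at hd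
  have hl : p.length ≤ 2 := by exact_mod_cast hd
  match p, hl with
  | .nil, _ => exact absurd rfl hab
  | .cons e .nil, _ => exact Or.inl e
  | .cons (v := c) e (.cons f .nil), _ => exact Or.inr ⟨c, c.2, e, f⟩
  | .cons _ (.cons _ (.cons _ _)), hl => simp at hl

/-- If the closed neighbourhood of a vertex of maximum degree is contained in that of
another vertex, then the closed neighbourhoods agree. -/
theorem SimpleGraph.insert_neighborSet_eq_of_subset {V : Type*} [Fintype V] {G : SimpleGraph V}
    [DecidableRel G.Adj] {v u : V} (hv : G.degree v = G.maxDegree)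
    (h : insert v (G.neighborSet v) ⊆ insert u (G.neighborSet u)) :
    insert v (G.neighborSet v) = insert u (G.neighborSet u) := by
  have card (w : V) : (insert w (G.neighborSet w)).ncard = G.degree w + 1 := by
    rw [Set.ncard_insert_of_notMem (by simp), ← G.card_neighborSet_eq_degree w,
      Set.ncard_eq_toFinset_card', Set.toFinset_card]
  refine Set.eq_of_subset_of_ncard_le h ?_ (Set.toFinite _)
  rw [card, card, hv]
  exact Nat.succ_le_succ (G.degree_le_maxDegree u)

/-- Lemma 3: if `G` is a locally isometric graph of order at least `3` with no pair
of true twins of degree `Δ(G)`, `v` has degree `Δ(G)` and `x ∈ N(v)`, then `x` has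
two distinct neighbours in `N(v) \ {x}`. -/
theorem locallyIsometric_two_neighbours_in_neighbourhood
    {V : Type*} [Fintype V] (G : SimpleGraph V) [DecidableRel G.Adj]
    (hli : LocallyIsometric G) (hn : 3 ≤ Fintype.card V)
    (hnt : ¬∃ u w : V, u ≠ w ∧
      insert u (G.neighborSet u) = insert w (G.neighborSet w) ∧
      G.degree u = G.maxDegree)
    (x v : V) (hx : x ∈ G.neighborSet v) (hv : G.degree v = G.maxDegree) :
    ∃ y z : V, y ∈ G.neighborSet v ∧ z ∈ G.neighborSet v ∧
      y ≠ x ∧ z ≠ x ∧ y ≠ z ∧ G.Adj x y ∧ G.Adj x z := by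
  by_contra hno
  have huniq : ∀ y z, G.Adj v y → G.Adj v z → G.Adj x y → G.Adj x z → y = z := by
    intro y z hy hz hxy hxz
    by_contra hyz
    exact hno ⟨y, z, hy, hz, hxy.ne', hxz.ne', hyz, hxy, hxz⟩
  have hx' : G.Adj v x := hx
  obtain ⟨u, huv, hu⟩ : ∃ u, G.Adj v u ∧ ∀ z, G.Adj v z → z = u ∨ G.Adj u z := by
    by_cases hy : ∃ y, G.Adj v y ∧ G.Adj x y
    · obtain ⟨y, hvy, hxy⟩ := hy
      refine ⟨y, hvy, fun z hz => ?_⟩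
      by_cases hzx : x = z
      · exact Or.inr (hzx ▸ hxy.symm)
      rcases hli.adj_or_exists_common hx' hz hzx with h | ⟨c, hvc, hxc, hcz⟩
      · exact Or.inl (huniq _ _ hz hvy h hxy)
      · exact Or.inr (huniq _ _ hvc hvy hxc hxy ▸ hcz)
    · refine ⟨x, hx', fun z hz => ?_⟩
      by_cases hzx : x = z
      · exact Or.inl hzx.symm
      rcases hli.adj_or_exists_common hx' hz hzx with h | ⟨c, hvc, hxc, -⟩
      · exact Or.inr h
      · exact absurd ⟨c, hvc, hxc⟩ hy
  refine hnt ⟨v, u, huv.ne, insert_neighborSet_eq_of_subset hv ?_, hv⟩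
  rintro z (rfl | hz)
  · exact Or.inr huv.symm
  · exact hu z hz
end

section
/- Let G be a locally isometric graph and let x, v be vertices of G such that deg(v) = k and x ∈ N(v). If there exists a set S ⊆ N(v) \ {x} with |S| = k - 2 such that x is adjacent to no vertex of S, then there is a vertex y ∈ N(v) that is adjacent to every other vertex of N(v) (i.e., y is a universal vertex of the subgraph induced by N(v)). Moreover, if k = Δ(G), then y and v are true twins. -/
open SimpleGraph

/-- In a graph of diameter at most `2`, distinct vertices are adjacent or have a common
neighbour. -/
theorem SimpleGraph.adj_or_exists_adj_adj_of_ediam_le_two {W : Type*} {H : SimpleGraph W}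
    (h : H.ediam ≤ 2) {a b : W} (hab : a ≠ b) :
    H.Adj a b ∨ ∃ w, H.Adj a w ∧ H.Adj w b := by
  have hd : H.edist a b ≤ 2 := edist_le_ediam.trans h
  obtain ⟨p, hp⟩ := exists_walk_of_edist_ne_top (ne_top_of_le_ne_top (by simp) hd)
  have hlen : p.length ≤ 2 := by
    rw [← hp] at hd
    exact_mod_cast hd
  match p, hlen with
  | .nil, _ => exact absurd rfl hab
  | .cons e .nil, _ => exact .inl e
  | .cons e (.cons f .nil), _ => exact .inr ⟨_, e, f⟩
  | .cons _ (.cons _ (.cons _ _)), hlen =>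
    simp only [Walk.length_cons] at hlen
    omega

/-- In a locally isometric graph, distinct neighbours of `v` are adjacent or have a common
neighbour in the neighbourhood of `v`. -/
theorem LocallyIsometric.adj_or_exists_adj_adj {V : Type*} {G : SimpleGraph V}
    (hli : LocallyIsometric G) {v a b : V} (ha : G.Adj v a) (hb : G.Adj v b) (hab : a ≠ b) :
    G.Adj a b ∨ ∃ w, G.Adj v w ∧ G.Adj a w ∧ G.Adj w b := by
  rcases adj_or_exists_adj_adj_of_ediam_le_two (hli v)
    (a := ⟨a, ha⟩) (b := ⟨b, hb⟩) (fun h ↦ hab (congrArg Subtype.val h)) with h | ⟨w, h₁, h₂⟩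
  · exact .inl h
  · exact .inr ⟨w, w.2, h₁, h₂⟩

/-- A neighbour of a vertex `v` of maximum degree that is adjacent to all other neighbours
of `v` is a true twin of `v`. -/
theorem SimpleGraph.insert_neighborSet_eq_of_degree_eq_maxDegree {V : Type*} [Fintype V]
    (G : SimpleGraph V) [DecidableRel G.Adj] {v y : V} (hy : G.Adj v y)
    (huniv : ∀ z, G.Adj v z → z ≠ y → G.Adj y z) (hdeg : G.degree v = G.maxDegree) :
    insert y (G.neighborSet y) = insert v (G.neighborSet v) := by
  classical
  have hsub : insert v (G.neighborFinset v) ⊆ insert y (G.neighborFinset y) := by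
    intro z hz
    rw [Finset.mem_insert, mem_neighborFinset] at hz ⊢
    rcases hz with rfl | hz
    · exact .inr hy.symm
    · exact or_iff_not_imp_left.2 (huniv z hz)
  have hcard : (insert y (G.neighborFinset y)).card ≤ (insert v (G.neighborFinset v)).card := by
    rw [Finset.card_insert_of_notMem (by simp), Finset.card_insert_of_notMem (by simp),
      card_neighborFinset_eq_degree, card_neighborFinset_eq_degree, hdeg]
    exact Nat.add_le_add_right (G.degree_le_maxDegree y) 1
  have heq := Finset.eq_of_subset_of_card_le hsub hcard
  ext z
  simpa using (Finset.ext_iff.1 heq z).symm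

/-- If `x ∈ N(v)` and `S ⊆ N(v) \ {x}` has `deg v - 2` elements, then `N(v) ⊆ S ∪ {x, y}`
for some `y ∈ N(v)`, which can be chosen different from `x` unless `N(v) = {x}`. -/
theorem SimpleGraph.exists_adj_forall_adj_mem_or_eq {V : Type*} [Fintype V]
    (G : SimpleGraph V) [DecidableRel G.Adj] {v x : V} (hx : G.Adj v x) {S : Finset V}
    (hS : (S : Set V) ⊆ G.neighborSet v \ {x}) (hcard : S.card = G.degree v - 2) :
    ∃ y, G.Adj v y ∧ (y = x → ∀ z, G.Adj v z → z = x) ∧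
      ∀ z, G.Adj v z → z ∈ S ∨ z = x ∨ z = y := by
  classical
  set T := (G.neighborFinset v).erase x \ S with hT
  have hmem : ∀ z, z ∈ T ↔ (z ≠ x ∧ G.Adj v z) ∧ z ∉ S := fun z ↦ by simp [hT]
  have hsub : S ⊆ (G.neighborFinset v).erase x := fun z hz ↦ by
    have := hS hz
    simp_all
  have hTcard : T.card = G.degree v - 1 - (G.degree v - 2) := by
    rw [hT, Finset.card_sdiff_of_subset hsub, Finset.card_erase_of_mem (by simpa using hx),
      card_neighborFinset_eq_degree, hcard]
  have hone : T.card ≤ 1 := by omega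
  rcases T.eq_empty_or_nonempty with hempty | ⟨y, hy⟩
  · have hS0 : S = ∅ := by
      rw [← Finset.card_eq_zero]
      rw [hempty, Finset.card_empty] at hTcard
      omega
    have hall : ∀ z, G.Adj v z → z = x := fun z hz ↦ by
      by_contra hzx
      have : z ∈ T := (hmem z).2 ⟨⟨hzx, hz⟩, by simp [hS0]⟩
      simp [hempty] at this
    exact ⟨x, hx, fun _ ↦ hall, fun z hz ↦ .inr (.inl (hall z hz))⟩
  · obtain ⟨⟨hyx, hvy⟩, -⟩ := (hmem y).1 hy
    refine ⟨y, hvy, fun h ↦ absurd h hyx, fun z hz ↦ ?_⟩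
    by_contra! hcon
    exact hcon.2.2 (Finset.card_le_one.1 hone z ((hmem z).2 ⟨⟨hcon.2.1, hz⟩, hcon.1⟩) y hy)


/-- Lemma 4: let `G` be locally isometric, `deg v = k` and `x ∈ N(v)`.  If there is
a set `S ⊆ N(v) \ {x}` with `|S| = k - 2` and `x` adjacent to no vertex of `S`, then
some `y ∈ N(v)` is universal in the subgraph induced by `N(v)`; moreover if
`k = Δ(G)`, then `y` and `v` are true twins. -/
theorem locallyIsometric_universal_vertex_of_nonneighbours
    {V : Type*} [Fintype V] (G : SimpleGraph V) [DecidableRel G.Adj]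
    (hli : LocallyIsometric G) (x v : V) (k : ℕ)
    (hv : G.degree v = k) (hx : x ∈ G.neighborSet v)
    (S : Finset V) (hS : (S : Set V) ⊆ G.neighborSet v \ {x})
    (hScard : S.card = k - 2) (hSnonadj : ∀ s ∈ S, ¬G.Adj x s) :
    ∃ y ∈ G.neighborSet v,
      (∀ z ∈ G.neighborSet v, z ≠ y → G.Adj y z) ∧
      (k = G.maxDegree →
        insert y (G.neighborSet y) = insert v (G.neighborSet v)) := by
  subst hv
  obtain ⟨y, hy, hyx, hcover⟩ := G.exists_adj_forall_adj_mem_or_eq hx hS hScard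
  have huniv : ∀ z, G.Adj v z → z ≠ y → G.Adj y z := by
    intro z hz hzy
    have hxy : y ≠ x := fun h ↦ hzy ((hyx h z hz).trans h.symm)
    have key : ∀ w, G.Adj v w → G.Adj x w → w = y := fun w hw hxw ↦ by
      rcases hcover w hw with h | h | h
      · exact absurd hxw (hSnonadj w h)
      · exact absurd h.symm hxw.ne
      · exact h
    by_cases hzx : z = x
    · subst hzx
      rcases hli.adj_or_exists_adj_adj hx hy hxy.symm with h | ⟨w, hw, h₁, h₂⟩
      · exact h.symm
      · exact absurd (key w hw h₁) h₂.ne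
    · rcases hli.adj_or_exists_adj_adj hx hz (Ne.symm hzx) with h | ⟨w, hw, h₁, h₂⟩
      · exact absurd (key z hz h) hzy
      · exact key w hw h₁ ▸ h₂
  exact ⟨y, hy, huniv, G.insert_neighborSet_eq_of_degree_eq_maxDegree hy huniv⟩
end

section
/- Let G be a locally isometric graph, let S be a nonempty set of vertices of G, and let w be a vertex of G not in S. If w is adjacent to every vertex of S and w is adjacent to no vertex of N(S) \ (S ∪ {w}), then N(w) = S, where N(S) denotes the union of the open neighbourhoods of the vertices of S. -/
open SimpleGraph

/-- Lemma 5: let `G` be locally isometric, `S` a nonempty set of vertices and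
`w ∉ S` a vertex adjacent to every vertex of `S` and to no vertex of
`N(S) \ (S ∪ {w})`.  Then `N(w) = S`. -/
theorem locallyIsometric_neighbourhood_eq_of_adj_all
    {V : Type*} (G : SimpleGraph V) (hli : LocallyIsometric G)
    (S : Set V) (hSne : S.Nonempty) (w : V) (hw : w ∉ S)
    (hadj : ∀ s ∈ S, G.Adj w s)
    (hnonadj : ∀ y ∈ (⋃ s ∈ S, G.neighborSet s) \ (S ∪ {w}), ¬G.Adj w y) :
    G.neighborSet w = S := by
  refine Set.Subset.antisymm (fun x hx => ?_) hadj
  obtain ⟨s, hs⟩ := hSne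
  have reach : (G.induce (G.neighborSet w)).Reachable ⟨s, hadj s hs⟩ ⟨x, hx⟩ := by
    rw [← edist_ne_top_iff_reachable]
    exact ((edist_le_ediam.trans (hli w)).trans_lt (by decide)).ne
  obtain ⟨p⟩ := reach
  have mem_of_walk : ∀ {a b : G.neighborSet w},
      (G.induce (G.neighborSet w)).Walk a b → a.1 ∈ S → b.1 ∈ S := by
    intro a b p
    induction p with
    | nil => exact id
    | @cons u v _ h _ ih =>
      intro hu
      refine ih (by_contra fun hv => hnonadj v.1 ⟨?_, ?_⟩ v.2)
      · exact Set.mem_biUnion hu h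
      · rintro (h' | h')
        · exact hv h'
        · exact G.ne_of_adj v.2 h'.symm
  exact mem_of_walk p hs
end

section
/- If G is a connected locally isometric graph of order n ≥ 4 with maximum degree Δ(G) = 3, then G is isomorphic to K_4 or to K_4 minus one edge. -/
open SimpleGraph

/-- In a locally isometric graph, a non-pendant edge lies in a triangle. -/
lemma LocallyIsometric.exists_common_neighbor_s9 {V : Type*} {G : SimpleGraph V}
    (hli : LocallyIsometric G) {v x w : V} (hx : G.Adj v x) (hw : G.Adj v w) (hne : x ≠ w) :
    ∃ y, G.Adj v y ∧ G.Adj x y := by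
  have : Nonempty (G.neighborSet v) := ⟨⟨x, hx⟩⟩
  have hc : (G.induce (G.neighborSet v)).Connected :=
    connected_of_ediam_ne_top (ne_top_of_le_ne_top (by decide) (hli v))
  have : Nontrivial (G.neighborSet v) :=
    ⟨⟨⟨x, hx⟩, ⟨w, hw⟩, fun h => hne (congrArg Subtype.val h)⟩⟩
  obtain ⟨y, hy⟩ := hc.preconnected.exists_adj_of_nontrivial ⟨x, hx⟩
  exact ⟨y, y.2, hy⟩

lemma SimpleGraph.Connected.forall_mem_of_adj_closed {V : Type*} {G : SimpleGraph V}
    (hG : G.Connected) {S : Set V} {v : V} (hv : v ∈ S)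
    (hS : ∀ x ∈ S, ∀ y, G.Adj x y → y ∈ S) (w : V) : w ∈ S := by
  obtain ⟨p⟩ := hG.preconnected v w
  induction p with
  | nil => exact hv
  | cons h _ ih => exact ih (hS _ hv _ h)

lemma SimpleGraph.eq_of_adj_of_degree_le_three {V : Type*} [Fintype V] {G : SimpleGraph V}
    [DecidableRel G.Adj] {u a b c d : V} (hdeg : G.degree u ≤ 3)
    (ha : G.Adj u a) (hb : G.Adj u b) (hc : G.Adj u c) (hd : G.Adj u d)
    (hab : a ≠ b) (hac : a ≠ c) (hbc : b ≠ c) : d = a ∨ d = b ∨ d = c := by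
  classical
  by_contra! h
  have hsub : ({d, a, b, c} : Finset V) ⊆ G.neighborFinset u := by
    intro x hx
    simp only [Finset.mem_insert, Finset.mem_singleton] at hx
    rcases hx with rfl | rfl | rfl | rfl <;> simpa
  have hle := Finset.card_le_card hsub
  rw [card_neighborFinset_eq_degree] at hle
  have hcard : ({d, a, b, c} : Finset V).card = 4 := by simp [h, hab, hac, hbc]
  omega

/-- A vertex with neighbours `a`, `b`, `c` that induce a graph containing the path `a b c`
forces the whole graph. -/
lemma LocallyIsometric.nonempty_iso_of_path {V : Type*} [Fintype V] {G : SimpleGraph V}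
    [DecidableRel G.Adj] (hconn : G.Connected) (hli : LocallyIsometric G)
    (hdeg : ∀ u, G.degree u ≤ 3) {v a b c : V}
    (hva : G.Adj v a) (hvb : G.Adj v b) (hvc : G.Adj v c)
    (hac : a ≠ c) (hab : G.Adj a b) (hbc : G.Adj b c) :
    Nonempty (G ≃g (⊤ : SimpleGraph (Fin 4))) ∨
      Nonempty (G ≃g ((⊤ : SimpleGraph (Fin 4)).deleteEdges {s(0, 1)})) := by
  have hNv : ∀ x, G.Adj v x → x = a ∨ x = b ∨ x = c := fun x hx =>
    eq_of_adj_of_degree_le_three (hdeg v) hva hvb hvc hx hab.ne hac hbc.ne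
  have hNb : ∀ x, G.Adj b x → x = a ∨ x = v ∨ x = c := fun x hx =>
    eq_of_adj_of_degree_le_three (hdeg b) hab.symm hvb.symm hbc hx hva.ne' hac hvc.ne
  have hend : ∀ {d}, G.Adj v d → G.Adj d b → ∀ x, G.Adj d x →
      x = a ∨ x = c ∨ x = b ∨ x = v := by
    intro d hvd hdb x hx
    by_contra! h
    obtain ⟨y, hdy, hxy⟩ := hli.exists_common_neighbor_s9 hx hvd.symm h.2.2.2
    rcases eq_of_adj_of_degree_le_three (hdeg d) hvd.symm hdb hx hdy hvb.ne
      h.2.2.2.symm h.2.2.1.symm with rfl | rfl | rfl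
    · grind [hNv x hxy.symm]
    · grind [hNb x hxy.symm]
    · exact G.irrefl hxy
  have hall : ∀ x, x = a ∨ x = c ∨ x = b ∨ x = v := by
    refine hconn.forall_mem_of_adj_closed (S := {x | x = a ∨ x = c ∨ x = b ∨ x = v})
      (v := v) (by simp) ?_
    rintro x (rfl | rfl | rfl | rfl) y hy
    · exact hend hva hab y hy
    · exact hend hvc hbc.symm y hy
    · grind [hNb y hy]
    · grind [hNv y hy]
  have hbij : Function.Bijective ![a, c, b, v] := by
    constructor
    · have := hab.ne
      have := hbc.ne
      have := hva.ne
      have := hvb.ne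
      have := hvc.ne
      intro i j hij
      fin_cases i <;> fin_cases j <;> simp_all
    · intro x
      rcases hall x with rfl | rfl | rfl | rfl
      exacts [⟨0, rfl⟩, ⟨1, rfl⟩, ⟨2, rfl⟩, ⟨3, rfl⟩]
  by_cases hadj : G.Adj a c
  · refine .inl ⟨Iso.symm ⟨Equiv.ofBijective _ hbij, ?_⟩⟩
    intro i j
    fin_cases i <;> fin_cases j <;> simp [*, G.adj_comm]
  · refine .inr ⟨Iso.symm ⟨Equiv.ofBijective _ hbij, ?_⟩⟩
    have hadj' : ¬ G.Adj c a := fun h => hadj h.symm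
    intro i j
    fin_cases i <;> fin_cases j <;>
      simp [hva, hvb, hvc, hab, hbc, hva.symm, hvb.symm, hvc.symm, hab.symm, hbc.symm, hadj, hadj']

/-- A connected locally isometric graph of order at least `4` with maximum degree
`3` is isomorphic to `K₄` or to `K₄` minus an edge. -/
theorem locallyIsometric_maxDegree_three
    {V : Type*} [Fintype V] (G : SimpleGraph V) [DecidableRel G.Adj]
    (hconn : G.Connected) (hli : LocallyIsometric G)
    (hn : 4 ≤ Fintype.card V) (hmax : G.maxDegree = 3) :
    Nonempty (G ≃g (⊤ : SimpleGraph (Fin 4))) ∨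
      Nonempty (G ≃g ((⊤ : SimpleGraph (Fin 4)).deleteEdges {s(0, 1)})) := by
  classical
  have hdeg : ∀ u, G.degree u ≤ 3 := fun u => hmax ▸ G.degree_le_maxDegree u
  have := hconn.nonempty
  obtain ⟨v, hv⟩ := G.exists_maximal_degree_vertex
  obtain ⟨a, b, c, hab, hac, hbc, hN⟩ := Finset.card_eq_three.mp (hv.symm.trans hmax)
  have hN' : ∀ x, G.Adj v x ↔ x = a ∨ x = b ∨ x = c := fun x => by
    rw [← mem_neighborFinset, hN]
    simp
  have hva : G.Adj v a := by simp [hN']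
  have hvb : G.Adj v b := by simp [hN']
  have hvc : G.Adj v c := by simp [hN']
  have ha : G.Adj a b ∨ G.Adj a c := by
    obtain ⟨y, hy, h⟩ := hli.exists_common_neighbor_s9 hva hvb hab
    rcases (hN' y).mp hy with rfl | rfl | rfl <;> simp_all
  have hb : G.Adj b a ∨ G.Adj b c := by
    obtain ⟨y, hy, h⟩ := hli.exists_common_neighbor_s9 hvb hva hab.symm
    rcases (hN' y).mp hy with rfl | rfl | rfl <;> simp_all
  have hc : G.Adj c a ∨ G.Adj c b := by
    obtain ⟨y, hy, h⟩ := hli.exists_common_neighbor_s9 hvc hva hac.symm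
    rcases (hN' y).mp hy with rfl | rfl | rfl <;> simp_all
  rcases ha with h | h
  · rcases hc with h' | h'
    · exact hli.nonempty_iso_of_path hconn hdeg hvb hva hvc hbc h.symm h'.symm
    · exact hli.nonempty_iso_of_path hconn hdeg hva hvb hvc hac h h'.symm
  · rcases hb with h' | h'
    · exact hli.nonempty_iso_of_path hconn hdeg hvb hva hvc hbc h' h
    · exact hli.nonempty_iso_of_path hconn hdeg hva hvc hvb hab h h'.symm
end

section
/- If G is a connected locally isometric graph of order n ≥ 5 with maximum degree Δ(G) = 4 that is not fully cycle extendable, then G is isomorphic to K_2 + K̄_3, the join of a complete graph on 2 vertices with the empty graph on 3 vertices (equivalently, the complete multipartite graph K_{1,1,3}). -/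
open SimpleGraph

/-- `G` is fully cycle extendable: every vertex lies on a triangle and every
non-Hamiltonian cycle extends to a cycle on the same vertices plus one more. -/
def FullyCycleExtendable {V : Type*} [DecidableEq V] (G : SimpleGraph V) : Prop :=
  (∀ v : V, ∃ u w : V, G.Adj v u ∧ G.Adj u w ∧ G.Adj w v) ∧
  ∀ (a : V) (c : G.Walk a a), c.IsCycle → ¬c.IsHamiltonianCycle →
    ∃ x ∉ c.support, HasCycleOn G (insert x {y | y ∈ c.support})

namespace SimpleGraph

variable {V : Type*} {G : SimpleGraph V}

/-- Two distinct nonadjacent vertices in a neighbourhood of diameter at most two have a common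
neighbour inside it. -/
lemma _root_.LocallyIsometric.exists_common_neighbor_s10 (hli : LocallyIsometric G) {v a b : V}
    (ha : G.Adj v a) (hb : G.Adj v b) (hab : a ≠ b) (hnab : ¬G.Adj a b) :
    ∃ c, G.Adj v c ∧ G.Adj a c ∧ G.Adj c b := by
  have h : (G.induce (G.neighborSet v)).edist ⟨a, ha⟩ ⟨b, hb⟩ ≤ 2 := edist_le_ediam.trans (hli v)
  obtain ⟨p, hp⟩ := exists_walk_of_edist_ne_top (ne_top_of_le_ne_top (by simp) h)
  have hl : p.length ≤ 2 := by
    rw [← hp] at h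
    exact_mod_cast h
  match p, hl with
  | .nil, _ => exact absurd rfl hab
  | .cons h .nil, _ => exact absurd h hnab
  | .cons (v := c) h (.cons h' .nil), _ => exact ⟨c, c.2, h, h'⟩
  | .cons _ (.cons _ (.cons _ _)), hl => simp at hl

/-- In a connected graph, a nonempty set closed under adjacency contains every vertex. -/
lemma Connected.mem_of_adj_closed (hconn : G.Connected) {s : Set V} {a : V} (ha : a ∈ s)
    (hs : ∀ x ∈ s, ∀ y, G.Adj x y → y ∈ s) (b : V) : b ∈ s := by
  obtain ⟨p⟩ := hconn a b
  induction p with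
  | nil => exact ha
  | cons h _ ih => exact ih (hs _ ha _ h)

/-- A path with distinct ends and a vertex off it adjacent to both ends close up to a cycle. -/
lemma Walk.IsPath.hasCycleOn {u v w : V} {q : G.Walk u w} (hq : q.IsPath) (huw : u ≠ w)
    (hv : v ∉ q.support) (hvu : G.Adj v u) (hvw : G.Adj v w) :
    HasCycleOn G (insert v {x | x ∈ q.support}) := by
  refine ⟨v, .cons hvu (q.concat hvw.symm), ?_, ?_⟩
  · refine (Walk.cons_isCycle_iff _ _).2 ⟨hq.concat hv _, ?_⟩
    rw [Walk.edges_concat, List.concat_eq_append, List.mem_append]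
    rintro (h | h)
    · exact hv (q.fst_mem_support_of_mem_edges h)
    · simp at h
      grind [hvw.ne]
  · ext x
    simp [Walk.support_concat]
    grind

/-- Removing a vertex from a cycle leaves a path joining two of its neighbours. -/
lemma Walk.IsCycle.exists_isPath [DecidableEq V] {a v : V} {c : G.Walk a a} (hc : c.IsCycle)
    (hv : v ∈ c.support) :
    ∃ (u w : V) (q : G.Walk u w), q.IsPath ∧ u ≠ w ∧ v ∉ q.support ∧ G.Adj v u ∧ G.Adj v w ∧
      {x | x ∈ c.support} = insert v {x | x ∈ q.support} := by
  have hset : {x | x ∈ c.support} = {x | x ∈ (c.rotate v hv).support} := by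
    ext x
    exact (Walk.mem_support_rotate_iff c v hv).symm
  have hc' : (c.rotate v hv).IsCycle := (Walk.isCycle_rotate hv).2 hc
  rw [hset]
  generalize c.rotate v hv = d at hc'
  cases d with
  | nil => simp at hc'
  | cons h p =>
    rename_i u
    cases p with
    | nil => exact absurd h G.irrefl
    | cons h₁ p' =>
      obtain ⟨w, q, h', hq⟩ := Walk.exists_cons_eq_concat h₁ p'
      rw [hq] at hc' ⊢
      obtain ⟨hp, he⟩ := (Walk.cons_isCycle_iff _ _).1 hc'
      obtain ⟨hq', hvq⟩ := (Walk.concat_isPath_iff h').1 hp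
      refine ⟨u, w, q, hq', ?_, hvq, h, h'.symm, ?_⟩
      · rintro rfl
        simp [Walk.edges_concat, Sym2.eq_swap] at he
      · ext x
        simp [Walk.support_concat]
        grind

/-- A cycle through every vertex is Hamiltonian. -/
lemma Walk.IsCycle.isHamiltonianCycle_of_mem [DecidableEq V] {a : V} {c : G.Walk a a}
    (hc : c.IsCycle) (h : ∀ x, x ∈ c.support) : c.IsHamiltonianCycle := by
  rw [isHamiltonianCycle_isCycle_and_isHamiltonian_tail]
  refine ⟨hc, hc.isPath_tail.isHamiltonian_of_mem fun x => ?_⟩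
  rw [Walk.support_tail_of_not_nil _ hc.not_nil]
  have := h x
  rw [Walk.mem_support_iff] at this
  rcases this with rfl | h
  · exact Walk.end_mem_tail_support hc.not_nil
  · exact h

/-- A path whose first vertex has no neighbour on it other than its last vertex has no
interior vertices. -/
lemma Walk.IsPath.mem_support_of_adj_eq {y u : V} {p : G.Walk y u} (hp : p.IsPath)
    (h : ∀ z ∈ p.support, G.Adj y z → z = u) {z : V} (hz : z ∈ p.support) : z = y ∨ z = u := by
  cases p with
  | nil => simpa using hz
  | cons hyb r =>
    obtain rfl := h _ (by simp) hyb
    obtain rfl := (Walk.isPath_iff_nil.1 hp.of_cons).eq_nil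
    simpa using hz

/-- If an interior vertex `y` of a path is adjacent on the path only to the two ends, then the
path has no other interior vertex. -/
lemma Walk.IsPath.mem_support_of_adj_ends {u y w : V} {q : G.Walk u w} (hq : q.IsPath)
    (hy : y ∈ q.support) (hyu : y ≠ u) (hyw : y ≠ w)
    (h : ∀ z ∈ q.support, G.Adj y z → z = u ∨ z = w) {z : V} (hz : z ∈ q.support) :
    z = u ∨ z = y ∨ z = w := by
  obtain ⟨r, s, hr, hs, rfl⟩ := hq.mem_support_iff_exists_append.1 hy
  have hd : ∀ z ∈ r.support, z ∈ s.support → z = y := fun z hzr hzs => by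
    by_contra hne
    exact hq.ne_of_mem_support_of_append hne hzr hzs rfl
  simp only [Walk.mem_support_append_iff] at h hz
  rcases hz with hz | hz
  · have := hr.reverse.mem_support_of_adj_eq (z := z) (fun x hx hyx => by
      rw [Walk.support_reverse, List.mem_reverse] at hx
      refine (h x (.inl hx) hyx).resolve_right fun hxw => ?_
      exact hyx.ne' (hd x hx (hxw ▸ s.end_mem_support))) (by simpa using hz)
    tauto
  · have := hs.mem_support_of_adj_eq (z := z) (fun x hx hyx => by
      refine (h x (.inr hx) hyx).resolve_left fun hxu => ?_
      exact hyx.ne' (hd x (hxu ▸ r.start_mem_support) hx)) hz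
    tauto

/-- A vertex of degree at most four with four known neighbours has no other neighbour. -/
lemma eq_of_adj_of_degree_le_four [Fintype V] [DecidableEq V] [DecidableRel G.Adj] {v a b c d : V}
    (hv : G.degree v ≤ 4) (ha : G.Adj v a) (hb : G.Adj v b) (hc : G.Adj v c) (hd : G.Adj v d)
    (hne : [a, b, c, d].Nodup) {z : V} (hz : G.Adj v z) : z = a ∨ z = b ∨ z = c ∨ z = d := by
  by_contra! hcon
  have hsub : [z, a, b, c, d].toFinset ⊆ G.neighborFinset v := by
    intro x hx
    simp at hx
    rw [mem_neighborFinset]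
    rcases hx with rfl | rfl | rfl | rfl | rfl <;> assumption
  have := Finset.card_le_card hsub
  rw [List.toFinset_card_of_nodup (by simp_all), card_neighborFinset_eq_degree] at this
  simp at this
  omega

/-- Every vertex of a connected locally isometric graph with at least three vertices lies on a
triangle. -/
lemma _root_.LocallyIsometric.exists_triangle [Fintype V] [DecidableEq V]
    (hli : LocallyIsometric G) (hconn : G.Connected) (hn : 3 ≤ Fintype.card V) (v : V) :
    ∃ u w : V, G.Adj v u ∧ G.Adj u w ∧ G.Adj w v := by
  by_contra! hno
  have hleaf : ∀ w, G.Adj v w → ∀ z, G.Adj w z → z = v := by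
    intro w hw z hz
    by_contra hzv
    by_cases hzv' : G.Adj z v
    · exact hno w z hw hz hzv'
    · obtain ⟨c, hc, -, hcv⟩ := hli.exists_common_neighbor_s10 hz hw.symm hzv hzv'
      exact hno w c hw hc hcv
  have huniq : ∀ w w', G.Adj v w → G.Adj v w' → w = w' := by
    intro w w' hw hw'
    by_contra hne
    by_cases had : G.Adj w w'
    · exact hno w w' hw had hw'.symm
    · obtain ⟨c, hc, hwc, -⟩ := hli.exists_common_neighbor_s10 hw hw' hne had
      exact hno w c hw hwc hc.symm
  have hall := hconn.mem_of_adj_closed (s := insert v (G.neighborSet v)) (a := v) (by simp)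
    (by
      rintro x (rfl | hx) y hy
      · exact .inr hy
      · exact .inl (hleaf x hx y hy))
  obtain ⟨a, b, c, hab, hac, hbc⟩ := Fintype.two_lt_card_iff.1 hn
  have ha := hall a
  have hb := hall b
  have hc := hall c
  simp only [Set.mem_insert_iff, mem_neighborSet] at ha hb hc
  grind

/-- A graph whose vertices are `v, y, u, w, x`, with `v` and `y` adjacent to everything and
`u, w, x` pairwise nonadjacent, is `K₁,₁,₃`. -/
lemma nonempty_iso_completeMultipartiteGraph [DecidableEq V] {v y u w x : V}
    (hnd : [v, y, u, w, x].Nodup) (hall : ∀ z, z ∈ [v, y, u, w, x])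
    (hvy : G.Adj v y) (hvu : G.Adj v u) (hvw : G.Adj v w) (hvx : G.Adj v x)
    (hyu : G.Adj y u) (hyw : G.Adj y w) (hyx : G.Adj y x)
    (huw : ¬G.Adj u w) (hux : ¬G.Adj u x) (hwx : ¬G.Adj w x) :
    Nonempty (G ≃g completeMultipartiteGraph ![Fin 1, Fin 1, Fin 3]) := by
  simp only [List.nodup_cons, List.mem_cons, List.not_mem_nil, not_or, or_false] at hnd hall
  obtain ⟨⟨hvy', hvu', hvw', hvx'⟩, ⟨hyu', hyw', hyx'⟩, ⟨huw', hux'⟩, hwx', -⟩ := hnd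
  let f : V → Σ i, ![Fin 1, Fin 1, Fin 3] i := fun z =>
    if z = v then ⟨0, (0 : Fin 1)⟩ else if z = y then ⟨1, (0 : Fin 1)⟩
    else if z = u then ⟨2, (0 : Fin 3)⟩ else if z = w then ⟨2, (1 : Fin 3)⟩ else ⟨2, (2 : Fin 3)⟩
  have fv : f v = ⟨0, (0 : Fin 1)⟩ := by simp [f]
  have fy : f y = ⟨1, (0 : Fin 1)⟩ := by simp [f, Ne.symm hvy']
  have fu : f u = ⟨2, (0 : Fin 3)⟩ := by simp [f, Ne.symm hvu', Ne.symm hyu']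
  have fw : f w = ⟨2, (1 : Fin 3)⟩ := by simp [f, Ne.symm hvw', Ne.symm hyw', Ne.symm huw']
  have fx : f x = ⟨2, (2 : Fin 3)⟩ := by
    simp [f, Ne.symm hvx', Ne.symm hyx', Ne.symm hux', Ne.symm hwx']
  have hadj : ∀ a b, (f a).1 ≠ (f b).1 ↔ G.Adj a b := by
    intro a b
    rcases hall a with rfl | rfl | rfl | rfl | rfl <;>
      rcases hall b with rfl | rfl | rfl | rfl | rfl <;>
      simp only [fv, fy, fu, fw, fx] <;> simp [*, hvy.symm, hvu.symm, hvw.symm, hvx.symm,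
        hyu.symm, hyw.symm, hyx.symm, mt Adj.symm huw, mt Adj.symm hux, mt Adj.symm hwx]
  let g : (Σ i, ![Fin 1, Fin 1, Fin 3] i) → V := fun p =>
    match p with
    | ⟨0, _⟩ => v
    | ⟨1, _⟩ => y
    | ⟨2, (j : Fin 3)⟩ => ![u, w, x] j
  have hinj : Function.Injective f := by
    refine Function.LeftInverse.injective (g := g) fun a => ?_
    rcases hall a with rfl | rfl | rfl | rfl | rfl <;> simp only [fv, fy, fu, fw, fx] <;> rfl
  have hsurj : Function.Surjective f := by
    rintro ⟨i, j⟩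
    match i, j with
    | 0, (j : Fin 1) => exact ⟨v, by rw [fv, Subsingleton.elim j 0]⟩
    | 1, (j : Fin 1) => exact ⟨y, by rw [fy, Subsingleton.elim j 0]⟩
    | 2, (0 : Fin 3) => exact ⟨u, fu⟩
    | 2, (1 : Fin 3) => exact ⟨w, fw⟩
    | 2, (2 : Fin 3) => exact ⟨x, fx⟩
  exact ⟨Equiv.ofBijective f ⟨hinj, hsurj⟩, fun {a b} => hadj a b⟩

end SimpleGraph

/-- A connected locally isometric graph of order at least `5` with maximum degree
`4` that is not fully cycle extendable is isomorphic to
`K₂ + K̄₃ = K_{1,1,3}` (the join of `K₂` with the empty graph on three vertices). -/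
theorem locallyIsometric_maxDegree_four_not_fullyCycleExtendable
    {V : Type*} [Fintype V] [DecidableEq V] (G : SimpleGraph V) [DecidableRel G.Adj]
    (hconn : G.Connected) (hli : LocallyIsometric G)
    (hn : 5 ≤ Fintype.card V) (hmax : G.maxDegree = 4)
    (hnfce : ¬FullyCycleExtendable G) :
    Nonempty (G ≃g completeMultipartiteGraph ![Fin 1, Fin 1, Fin 3]) := by
  have hdeg : ∀ v, G.degree v ≤ 4 := fun v => hmax ▸ G.degree_le_maxDegree v
  obtain ⟨a, c, hc, hcH, hext⟩ : ∃ (a : V) (c : G.Walk a a), c.IsCycle ∧ ¬c.IsHamiltonianCycle ∧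
      ∀ x ∉ c.support, ¬HasCycleOn G (insert x {y | y ∈ c.support}) := by
    by_contra! hcon
    exact hnfce ⟨hli.exists_triangle hconn (by omega), hcon⟩
  obtain ⟨v, hv, x, hvx, hxc⟩ : ∃ v ∈ c.support, ∃ x, G.Adj v x ∧ x ∉ c.support := by
    by_contra! hcon
    exact hcH (hc.isHamiltonianCycle_of_mem
      (hconn.mem_of_adj_closed (s := {x | x ∈ c.support}) c.start_mem_support hcon))
  obtain ⟨u, w, q, hq, huw, hvq, hvu, hvw, hset⟩ := hc.exists_isPath hv
  have hmem : ∀ z, z ∈ c.support ↔ z = v ∨ z ∈ q.support := fun z => Set.ext_iff.1 hset z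
  rw [hset] at hext
  have huq := q.start_mem_support
  have hwq := q.end_mem_support
  -- a vertex off the cycle cannot be inserted next to `v`
  have hins_u : ∀ z ∉ c.support, G.Adj v z → ¬G.Adj z u := by
    intro z hz hvz hzu
    have hzq : z ∉ q.support := fun h => hz ((hmem z).2 (.inr h))
    refine hext z hz ?_
    rw [Set.insert_comm]
    have := (hq.cons hzq (h := hzu)).hasCycleOn (v := v) (by grind)
      (by simp [hvz.ne, hvq]) hvz hvw
    convert this using 2
    ext t
    simp
  have hins_w : ∀ z ∉ c.support, G.Adj v z → ¬G.Adj z w := by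
    intro z hz hvz hzw
    have hzq : z ∉ q.support := fun h => hz ((hmem z).2 (.inr h))
    refine hext z hz ?_
    rw [Set.insert_comm]
    have := (hq.reverse.cons (by simpa using hzq) (h := hzw)).hasCycleOn (v := v) (by grind)
      (by simp [hvz.ne, hvq]) hvz hvu
    convert this using 2
    ext t
    simp
  have hxu := hins_u x hxc hvx
  have hxw := hins_w x hxc hvx
  have hxq : x ∉ q.support := fun h => hxc ((hmem x).2 (.inr h))
  have hxu' : x ≠ u := fun h => hxq (h ▸ huq)
  have hxw' : x ≠ w := fun h => hxq (h ▸ hwq)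
  obtain ⟨y, hvy, hxy, hyu⟩ := hli.exists_common_neighbor_s10 hvx hvu hxu' hxu
  have hyu' := hyu.ne
  have hyw' : y ≠ w := fun h => hxw (h ▸ hxy)
  have hNv : ∀ z, G.Adj v z → z = x ∨ z = u ∨ z = w ∨ z = y := fun z hz =>
    eq_of_adj_of_degree_le_four (hdeg v) hvx hvu hvw hvy
      (by simp [hxu', hxw', hxy.ne, huw, hyu'.symm, hyw'.symm]) hz
  have hyw : G.Adj y w := by
    obtain ⟨y', hvy', hxy', hyw⟩ := hli.exists_common_neighbor_s10 hvx hvw hxw' hxw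
    rcases hNv y' hvy' with rfl | rfl | rfl | rfl
    · exact absurd hxy' G.irrefl
    · exact absurd hxy' hxu
    · exact absurd hxy' hxw
    · exact hyw
  have hyc : y ∈ c.support := by
    by_contra hyc
    exact hins_u y hyc hvy hyu
  have hyq : y ∈ q.support := ((hmem y).1 hyc).resolve_left hvy.ne'
  have hNy : ∀ z, G.Adj y z → z = x ∨ z = u ∨ z = w ∨ z = v := fun z hz =>
    eq_of_adj_of_degree_le_four (hdeg y) hxy.symm hyu hyw hvy.symm
      (by simp [hxu', hxw', hvx.ne', huw, hvu.ne', hvw.ne']) hz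
  have hqs : ∀ z, z ∈ q.support ↔ z = u ∨ z = y ∨ z = w := by
    refine fun z => ⟨hq.mem_support_of_adj_ends hyq hyu' hyw' fun t ht hyt => ?_, by grind⟩
    have := hNy t hyt
    grind
  have huw_adj : ¬G.Adj u w := by
    intro had
    refine hext x hxc ?_
    have hp : (Walk.cons hxy (.cons hyu (.cons had .nil))).IsPath := by
      simp [Walk.cons_isPath_iff, hxy.ne, hxu', hxw', hyu', hyw', huw]
    have := hp.hasCycleOn (v := v) hxw'
      (by simp [hvx.ne, hvy.ne, hvu.ne, hvw.ne]) hvx hvw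
    convert this using 1
    ext t
    simp [hqs]
    grind
  -- a neighbour of `v` and `y` not adjacent to the other two has no further neighbour
  have hleaf : ∀ t, G.Adj v t → G.Adj y t → (∀ s, G.Adj v s → G.Adj t s → s = y) →
      ∀ z, G.Adj t z → z = v ∨ z = y := by
    intro t hvt hyt hts z htz
    by_contra! hcon
    by_cases hvz : G.Adj v z
    · exact hcon.2 (hts z hvz htz)
    · obtain ⟨s, hs, hvs, hsz⟩ := hli.exists_common_neighbor_s10 hvt.symm htz hcon.1.symm hvz
      obtain rfl := hts s hvs hs
      have h1 := hNy z hsz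
      grind [G.adj_comm]
  have hall : ∀ z, z ∈ [v, y, u, w, x] := by
    refine hconn.mem_of_adj_closed (s := {z | z ∈ [v, y, u, w, x]}) (a := v) (by simp) ?_
    intro t ht z htz
    simp only [Set.mem_ofPred_eq, List.mem_cons, List.not_mem_nil, or_false] at ht ⊢
    have hux : ¬G.Adj u x := fun h => hxu h.symm
    have hwx : ¬G.Adj w x := fun h => hxw h.symm
    have hwu : ¬G.Adj w u := fun h => huw_adj h.symm
    rcases ht with rfl | rfl | rfl | rfl | rfl
    · have := hNv z htz
      tauto
    · have := hNy z htz
      tauto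
    · have := hleaf t hvu hyu (fun s hs hts => by
        rcases hNv s hs with rfl | rfl | rfl | rfl <;> first | rfl | simp_all) z htz
      tauto
    · have := hleaf t hvw hyw (fun s hs hts => by
        rcases hNv s hs with rfl | rfl | rfl | rfl <;> first | rfl | simp_all) z htz
      tauto
    · have := hleaf t hvx hxy.symm (fun s hs hts => by
        rcases hNv s hs with rfl | rfl | rfl | rfl <;> first | rfl | simp_all) z htz
      tauto
  refine nonempty_iso_completeMultipartiteGraph ?_ hall hvy hvu hvw hvx hyu hyw hxy.symm huw_adj
    (fun h => hxu h.symm) (fun h => hxw h.symm)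
  simp [hvx.ne, hvy.ne, hvu.ne, hvw.ne, hyu', hyw', hxy.ne', huw, hxu'.symm, hxw'.symm]
end

section
/- If G is a locally isometric graph with maximum degree Δ(G) ≤ 5 and order n > Δ(G), then G is weakly pancyclic. -/
open SimpleGraph

/-- The set of lengths of cycles of `G`. -/
def cycleLengths {V : Type*} (G : SimpleGraph V) : Set ℕ :=
  {n | ∃ (a : V) (c : G.Walk a a), c.IsCycle ∧ c.length = n}

/-- `G` is weakly pancyclic: it has a cycle of every length `n` between its girth
and its circumference (vacuously true when `G` has no cycles). -/
def WeaklyPancyclic {V : Type*} (G : SimpleGraph V) : Prop :=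
  ∀ n : ℕ, (∃ m ∈ cycleLengths G, m ≤ n) → (∃ m ∈ cycleLengths G, n ≤ m) →
    n ∈ cycleLengths G

section

variable {V : Type*}

/-- A list of at least three distinct vertices that, read cyclically, traces a cycle of `G`. -/
structure IsCycleList (G : SimpleGraph V) (l : List V) : Prop where
  nodup : l.Nodup
  three_le : 3 ≤ l.length
  chain : (l : Cycle V).Chain G.Adj

theorem IsCycleList.rotate {G : SimpleGraph V} {l l' : List V} (h : IsCycleList G l)
    (hr : l ~r l') : IsCycleList G l' :=
  ⟨hr.nodup_iff.1 h.nodup, hr.perm.length_eq ▸ h.three_le, Cycle.coe_eq_coe.2 hr ▸ h.chain⟩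

theorem IsCycleList.reverse {G : SimpleGraph V} {l : List V} (h : IsCycleList G l) :
    IsCycleList G l.reverse := by
  refine ⟨List.nodup_reverse.2 h.nodup, by simpa using h.three_le, ?_⟩
  obtain _ | ⟨a, t⟩ := l
  · simp
  · have h₁ : (((a :: t).reverse : List V) : Cycle V) = ((a :: t.reverse : List V) : Cycle V) := by
      rw [List.reverse_cons]
      exact Cycle.coe_eq_coe.2 List.isRotated_append
    have h₂ := h.chain
    rw [Cycle.chain_coe_cons] at h₂
    rw [h₁, Cycle.chain_coe_cons]
    rw [← List.isChain_reverse] at h₂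
    simpa [G.adj_comm, flip] using h₂

theorem isCycleList_iff_isCycle {G : SimpleGraph V} (n : ℕ) :
    (∃ l, IsCycleList G l ∧ l.length = n) ↔ ∃ (a : V) (c : G.Walk a a), c.IsCycle ∧ c.length = n := by
  constructor
  · rintro ⟨_ | ⟨a, t⟩, ⟨h₁, h₂, h₃⟩, rfl⟩
    · simp at h₂
    rw [Cycle.chain_coe_cons] at h₃
    have key : ∀ (u w : V) (p : G.Walk u w), u = w → p.support = a :: (t ++ [a]) →
        ∃ (a : V) (c : G.Walk a a), c.IsCycle ∧ c.length = (a :: t).length := by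
      rintro u w p rfl hp
      have hl : p.length = t.length + 1 := by
        have := p.length_support
        rw [hp] at this
        simpa using this.symm
      refine ⟨u, p, Walk.isCycle_iff_isPath_tail_and_le_length.2 ⟨?_, ?_⟩, by simpa using hl⟩
      · have hnil : ¬ p.Nil := by
          rw [Walk.not_nil_iff_lt_length]; omega
        rw [Walk.isPath_def, Walk.support_tail_of_not_nil _ hnil, hp]
        simpa [List.nodup_append, ← List.forall_mem_ne', and_comm] using h₁
      · simp at h₂; omega
    exact key _ _ (Walk.ofSupport _ (by simp) h₃) (by simp) (Walk.support_ofSupport _ _)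
  · rintro ⟨a, c, hc, rfl⟩
    have h3 := hc.three_le_length
    cases c with
    | nil => simp at h3
    | cons h p =>
      have hs := p.dropLast_support_concat
      have hp := ((Walk.cons_isCycle_iff p h).1 hc).1.support_nodup
      have hch := p.isChain_adj_cons_support h
      have hlen : p.support.dropLast.length = p.length := by simp
      rw [← hs, List.nodup_append] at hp
      refine ⟨a :: p.support.dropLast, ⟨?_, ?_, ?_⟩, by simp⟩
      · exact List.nodup_cons.2 ⟨fun ha => hp.2.2 a ha a (by simp) rfl, hp.1⟩
      · simpa using h3
      · rwa [Cycle.chain_coe_cons, hs]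

theorem LocallyIsometric.exists_common {G : SimpleGraph V} (hG : LocallyIsometric G) {v a b : V}
    (ha : G.Adj v a) (hb : G.Adj v b) (hab : a ≠ b) (h : ¬ G.Adj a b) :
    ∃ c, G.Adj v c ∧ G.Adj a c ∧ G.Adj b c := by
  have h₁ := (edist_le_ediam (G := G.induce (G.neighborSet v)) (u := ⟨a, ha⟩) (v := ⟨b, hb⟩)).trans
    (hG v)
  obtain ⟨w, hw⟩ := exists_walk_of_edist_ne_top (ne_top_of_le_ne_top (by simp) h₁)
  rw [← hw] at h₁
  have h₁ : w.length ≤ 2 := by exact_mod_cast h₁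
  match w, h₁ with
  | .cons h₁ .nil, _ => exact absurd (by simpa using h₁) h
  | .cons (v := c) h₁ (.cons h₂ .nil), _ =>
    exact ⟨c, c.2, by simpa using h₁, by simpa using h₂.symm⟩
  | .nil, _ => exact absurd rfl hab

/-- `G` has maximum degree at most `5`, phrased without decidability assumptions. -/
def DegreeLEFive (G : SimpleGraph V) : Prop :=
  ∀ (v : V) (s : Finset V), (∀ y ∈ s, G.Adj v y) → s.card ≤ 5

/-- Any two nonadjacent neighbours of a vertex `v` have a common neighbour in its neighbourhood. -/
def LocallyCommon (G : SimpleGraph V) : Prop :=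
  ∀ ⦃v a b : V⦄, G.Adj v a → G.Adj v b → a ≠ b → ¬ G.Adj a b →
    ∃ c, G.Adj v c ∧ G.Adj a c ∧ G.Adj b c

theorem DegreeLEFive.mem {G : SimpleGraph V} (hG : DegreeLEFive G) {v y : V} {l : List V}
    (hl : l.Nodup) (h5 : l.length = 5) (hv : ∀ z ∈ l, G.Adj v z) (hy : G.Adj v y) : y ∈ l := by
  classical
  by_contra hn
  have h := hG v (y :: l).toFinset (by simpa [hy] using hv)
  rw [List.toFinset_card_of_nodup (List.nodup_cons.2 ⟨hn, hl⟩)] at h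
  simp [h5] at h

theorem IsCycleList.insert {G : SimpleGraph V} {a b y : V} {t : List V}
    (h : IsCycleList G (a :: b :: t)) (hy : y ∉ a :: b :: t) (ha : G.Adj y a) (hb : G.Adj y b) :
    IsCycleList G (a :: y :: b :: t) := by
  obtain ⟨h₁, h₂, h₃⟩ := h
  refine ⟨?_, by simp, ?_⟩
  · grind
  · rw [Cycle.chain_coe_cons] at h₃ ⊢
    simp only [List.cons_append, List.isChain_cons_cons] at h₃ ⊢
    exact ⟨ha.symm, hb, h₃.2⟩

/-- The cycle `p v q r` misses the neighbour `x` of `v`, and no cycle through `v` is longer by one. -/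
structure NonExtendable (G : SimpleGraph V) (v x p q : V) (r : List V) : Prop where
  isCycleList : IsCycleList G (p :: v :: q :: r)
  notMem : x ∉ p :: v :: q :: r
  adj : G.Adj v x
  length_ne : ∀ l, IsCycleList G l → v ∈ l → l.length ≠ r.length + 4

namespace NonExtendable

variable {G : SimpleGraph V} {v x p q : V} {r : List V}

theorem reverse_isRotated (p v q : V) (r : List V) :
    (p :: v :: q :: r).reverse ~r q :: v :: p :: r.reverse := by
  simpa using List.isRotated_append (l := r.reverse) (l' := [q, v, p])

theorem symm (h : NonExtendable G v x p q r) : NonExtendable G v x q p r.reverse where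
  isCycleList := h.isCycleList.reverse.rotate (reverse_isRotated p v q r)
  notMem := by have := h.notMem; simp at this ⊢; tauto
  adj := h.adj
  length_ne := by simpa using h.length_ne

theorem not_adj (h : NonExtendable G v x p q r) {w y z : V} {t : List V}
    (hr : (p :: v :: q :: r) ~r (y :: z :: t)) (hw : w ∉ p :: v :: q :: r)
    (hy : G.Adj w y) : ¬ G.Adj w z := by
  intro hz
  have hlen := hr.perm.length_eq
  refine h.length_ne _ ((h.isCycleList.rotate hr).insert (by rwa [← hr.mem_iff]) hy hz) ?_ ?_
  · have : v ∈ y :: z :: t := hr.mem_iff.1 (by simp)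
    simp at this ⊢; tauto
  · simp at hlen ⊢; omega

theorem not_adj_left (h : NonExtendable G v x p q r) {w : V} (hw : w ∉ p :: v :: q :: r)
    (hv : G.Adj w v) : ¬ G.Adj w p := fun hp => h.not_adj (.refl _) hw hp hv

theorem not_adj_right (h : NonExtendable G v x p q r) {w : V} (hw : w ∉ p :: v :: q :: r)
    (hv : G.Adj w v) : ¬ G.Adj w q :=
  h.not_adj (by simpa using List.isRotated_append (l := [p]) (l' := v :: q :: r)) hw hv

theorem not_adj_middle {s t : List V} {a b : V} (h : NonExtendable G v x p q (s ++ a :: b :: t))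
    {w : V} (hw : w ∉ p :: v :: q :: (s ++ a :: b :: t)) (ha : G.Adj w a) : ¬ G.Adj w b :=
  h.not_adj (by simpa using List.isRotated_append (l := p :: v :: q :: s) (l' := a :: b :: t)) hw ha

theorem adj_of_isRotated (h : NonExtendable G v x p q r) {y z : V} {t : List V}
    (hr : (p :: v :: q :: r) ~r (y :: z :: t)) : G.Adj y z := by
  have := (h.isCycleList.rotate hr).chain
  simp only [Cycle.chain_coe_cons, List.cons_append, List.isChain_cons_cons] at this
  exact this.1

theorem adj_left (h : NonExtendable G v x p q r) : G.Adj v p :=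
  (h.adj_of_isRotated (.refl _)).symm

theorem adj_right (h : NonExtendable G v x p q r) : G.Adj v q :=
  h.adj_of_isRotated (by simpa using List.isRotated_append (l := [p]) (l' := v :: q :: r))

theorem adj_middle {s t : List V} {a b : V} (h : NonExtendable G v x p q (s ++ a :: b :: t)) :
    G.Adj a b :=
  h.adj_of_isRotated
    (by simpa using List.isRotated_append (l := p :: v :: q :: s) (l' := a :: b :: t))

theorem adj_last {s : List V} {a : V} (h : NonExtendable G v x p q (s ++ [a])) : G.Adj a p :=
  h.adj_of_isRotated (by simpa using List.isRotated_append (l := p :: v :: q :: s) (l' := [a]))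

/-- The vertices `x` and `q` have a common neighbour in the neighbourhood of `v`, and it lies on
the cycle. -/
theorem exists_common (hL : LocallyCommon G) (h : NonExtendable G v x p q r) :
    ∃ a, G.Adj v a ∧ G.Adj x a ∧ G.Adj q a ∧ a ∈ r := by
  have hx := h.notMem
  have hq : ¬ G.Adj x q := h.not_adj_right hx h.adj.symm
  obtain ⟨a, h₁, h₂, h₃⟩ := hL h.adj h.adj_right (by rintro rfl; simp at hx) hq
  refine ⟨a, h₁, h₂, h₃, ?_⟩
  by_contra har
  by_cases hap : a = p
  · exact h.not_adj_left hx h.adj.symm (hap ▸ h₂)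
  · refine h.not_adj_right (w := a) ?_ h₁.symm h₃.symm
    have := h₁.ne'
    have := h₃.ne'
    simp; tauto

/-- If the common neighbour `a` of `v`, `x` and `q` is not adjacent to `p`, then it follows `q`. -/
theorem eq_cons_of_not_adj (hL : LocallyCommon G) (hD : DegreeLEFive G)
    (h : NonExtendable G v x p q r) {a b : V} (har : a ∈ r) (hbr : b ∈ r) (hab : a ≠ b)
    (hva : G.Adj v a) (hxa : G.Adj x a) (hqa : G.Adj q a) (hap : ¬ G.Adj a p)
    (hvb : G.Adj v b) (hxb : G.Adj x b) : ∃ r', r = a :: r' := by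
  have hx := h.notMem
  have hn := h.isCycleList.nodup
  have hvp := h.adj_left
  have hvq := h.adj_right
  have hvx := h.adj
  have hxq := h.not_adj_right hx hvx.symm
  obtain ⟨s, t, rfl⟩ := List.append_of_mem har
  obtain rfl | ⟨s, a', rfl⟩ := s.eq_nil_or_concat'
  · exact ⟨t, rfl⟩
  exfalso
  obtain _ | ⟨a'', t⟩ := t
  · exact hap h.adj_last
  have haa : G.Adj a a'' := h.adj_middle
  have hxa'' := h.not_adj_middle hx hxa
  rw [List.append_assoc] at h
  have haa' : G.Adj a' a := h.adj_middle
  have hxa' : ¬ G.Adj x a' := fun hh => h.not_adj_middle (by simpa using hx) hh hxa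
  simp [List.nodup_append, not_or, forall_and] at hn hx
  obtain ⟨c, h₁, h₂, h₃⟩ := hL hxa.symm haa (by grind) hxa''
  have hc := hD.mem (l := [v, q, x, a', a'']) (by simp; grind) rfl
    (by simp [hva.symm, hqa.symm, hxa.symm, haa, haa'.symm]) h₁
  have hcv : c = v := by
    have := h₃.ne
    have := h₂.ne
    simp at hc; grind
  subst hcv
  have hb : b ≠ a'' := by rintro rfl; exact hxa'' hxb
  have hb' := hvb.ne
  have hbp : b ≠ p := by rintro rfl; exact h.not_adj_left (by simp; tauto) hvx.symm hxb
  have hbq : b ≠ q := by rintro rfl; exact hxq hxb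
  have := hD.mem (l := [p, q, x, a, b]) (by have := hxb.ne; simp; grind) rfl
    (by simp [*]) h₃.symm
  simp at this; grind

theorem false_of_cons (hL : LocallyCommon G) (hD : DegreeLEFive G)
    (hS : ∀ x y, G.Adj x y → ∃ a b, G.Adj x a ∧ G.Adj x b ∧ a ≠ b ∧ ¬ G.Adj a b)
    {a : V} (h : NonExtendable G v x p q (a :: r))
    (hva : G.Adj v a) (hxa : G.Adj x a) (hpa : G.Adj p a) : False := by
  have hx := h.notMem
  have hn := h.isCycleList.nodup
  have hvp := h.adj_left
  have hvq := h.adj_right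
  have hvx := h.adj
  have hqa : G.Adj q a :=
    h.adj_of_isRotated (by simpa using List.isRotated_append (l := [p, v]) (l' := q :: a :: r))
  have hxp := h.not_adj_left hx hvx.symm
  have hxq := h.not_adj_right hx hvx.symm
  obtain ⟨y, hxy, hyv, hya⟩ : ∃ y, G.Adj x y ∧ y ≠ v ∧ y ≠ a := by
    by_contra! hcon
    obtain ⟨y, z, h₁, h₂, h₃, h₄⟩ := hS x v hvx.symm
    by_cases hyv : y = v
    · subst hyv
      exact h₄ (hcon z h₂ h₃.symm ▸ hva)
    · obtain rfl := hcon y h₁ hyv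
      by_cases hzv : z = v
      · exact h₄ (hzv ▸ hva.symm)
      · exact h₃ (hcon z h₂ hzv).symm
  have hyp : y ≠ p := by rintro rfl; exact hxp hxy
  have hyq : y ≠ q := by rintro rfl; exact hxq hxy
  have hxy' := hxy.ne
  obtain _ | ⟨a', t⟩ := r
  · simp [not_or] at hn hx
    have hpq : ¬ G.Adj p q := by
      intro hpq
      refine h.length_ne [p, q, v, x, a] ⟨?_, by simp, ?_⟩ (by simp) rfl
      · simp; grind
      · simp [hpq, hvq.symm, hvx, hxa, hpa.symm]
    suffices hy : ∃ y, y ≠ p ∧ y ≠ q ∧ G.Adj x y ∧ G.Adj v y ∧ G.Adj a y by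
      obtain ⟨y, hyp, hyq, hxy, hvy, hay⟩ := hy
      refine h.length_ne [v, x, y, a, q] ⟨?_, by simp, ?_⟩ (by simp) rfl
      · have := hxy.ne
        have := hvy.ne
        have := hay.ne
        simp; grind
      · simp [hvx, hxy, hay.symm, hqa.symm, hvq.symm]
    have key₁ : ∀ y, y ≠ p → y ≠ q → y ≠ a → G.Adj x y → G.Adj v y → G.Adj a y := by
      intro y hyp hyq hya hxy hvy
      have := hxy.ne
      have := hvy.ne
      have hyq' : ¬ G.Adj y q := h.not_adj_right (by simp; grind) hvy.symm
      obtain ⟨c, h₁, h₂, h₃⟩ := hL hvy hvq hyq hyq'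
      have hc := hD.mem (l := [p, q, x, a, y]) (by simp; grind) rfl (by simp [*]) h₁
      have := h₂.ne
      have := h₃.ne
      have := h₂.symm
      have := h₃.symm
      simp at hc; grind
    have key₂ : ∀ y, y ≠ p → y ≠ q → y ≠ v → G.Adj x y → G.Adj a y → G.Adj v y := by
      intro y hyp hyq hyv hxy hay
      have := hxy.ne
      have := hay.ne
      have hyq' : ¬ G.Adj y q := fun hh => h.not_adj
        (by simpa using List.isRotated_append (l := [p, v]) (l' := [q, a])) (by simp; grind)
        hh hay.symm
      obtain ⟨c, h₁, h₂, h₃⟩ := hL hay hqa.symm hyq hyq'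
      have hc := hD.mem (l := [p, q, x, v, y]) (by simp; grind) rfl
        (by simp [hpa.symm, hqa.symm, hxa.symm, hva.symm, hay]) h₁
      have := h₂.ne
      have := h₃.ne
      have := h₂.symm
      have := h₃.symm
      simp at hc; grind
    by_cases hvy : G.Adj v y
    · exact ⟨y, hyp, hyq, hxy, hvy, key₁ y hyp hyq hya hxy hvy⟩
    obtain ⟨c, h₁, h₂, h₃⟩ := hL hvx.symm hxy hyv.symm hvy
    by_cases hca : c = a
    · subst hca
      exact absurd (key₂ y hyp hyq hyv hxy h₃.symm) hvy
    · have hcp : c ≠ p := by rintro rfl; exact hxp h₁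
      have hcq : c ≠ q := by rintro rfl; exact hxq h₁
      exact ⟨c, hcp, hcq, h₁, h₂, key₁ c hcp hcq hca h₁ h₂⟩
  · have haa : G.Adj a a' := h.adj_middle (s := [])
    have hxa' : ¬ G.Adj x a' := h.not_adj_middle (s := []) hx hxa
    simp [not_or] at hn hx
    have hya' : y ≠ a' := by rintro rfl; exact hxa' hxy
    have hNa : ∀ z, G.Adj a z → z ∈ [x, v, q, p, a'] := fun z =>
      hD.mem (by simp; grind) rfl (by simp [hxa.symm, hva.symm, hqa.symm, hpa.symm, haa])
    obtain ⟨c, h₁, h₂, h₃⟩ := hL hxa.symm haa (by grind) hxa'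
    have hc := hNa c h₁
    have hcv : c = v := by
      have := h₂.ne
      have := h₃.ne
      simp at hc; grind
    subst hcv
    have hNv : ∀ z, G.Adj c z → z ∈ [x, a, q, p, a'] := fun z =>
      hD.mem (by simp; grind) rfl (by simp [hvx, hva, hvq, hvp, h₃.symm])
    have hvy : ¬ G.Adj c y := fun hh => by
      have := hNv y hh
      simp at this; grind
    obtain ⟨d, h₄, h₅, h₆⟩ := hL hvx.symm hxy hyv.symm hvy
    have hda : d = a := by
      have := hNv d h₅
      have := h₄.ne
      simp at this; grind
    subst hda
    have := hNa y h₆.symm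
    simp at this; grind

theorem false_of_adj (hL : LocallyCommon G) (hD : DegreeLEFive G)
    (hS : ∀ x y, G.Adj x y → ∃ a b, G.Adj x a ∧ G.Adj x b ∧ a ≠ b ∧ ¬ G.Adj a b)
    (h : NonExtendable G v x p q r) {a : V} (har : a ∈ r)
    (hva : G.Adj v a) (hxa : G.Adj x a) (hqa : G.Adj q a) (hpa : G.Adj p a) : False := by
  have hx := h.notMem
  have hn := h.isCycleList.nodup
  obtain ⟨s, t, rfl⟩ := List.append_of_mem har
  obtain rfl | ⟨s, a', rfl⟩ := s.eq_nil_or_concat'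
  · exact h.false_of_cons hL hD hS hva hxa hpa
  obtain _ | ⟨a'', t⟩ := t
  · have h' := h.symm
    rw [List.reverse_append] at h'
    exact h'.false_of_cons hL hD hS hva hxa hqa
  have haa : G.Adj a a'' := h.adj_middle
  rw [List.append_assoc] at h
  have haa' : G.Adj a' a := h.adj_middle
  simp [List.nodup_append, not_or, forall_and] at hn hx
  have := hD.mem (l := [x, v, q, p, a']) (by simp; grind) rfl
    (by simp [hxa.symm, hva.symm, hqa.symm, hpa.symm, haa'.symm]) haa
  simp at this; grind

/-- If every vertex of positive degree has two nonadjacent neighbours, then every cycle that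
misses a neighbour of one of its vertices can be extended by one. -/
theorem false (hL : LocallyCommon G) (hD : DegreeLEFive G)
    (hS : ∀ x y, G.Adj x y → ∃ a b, G.Adj x a ∧ G.Adj x b ∧ a ≠ b ∧ ¬ G.Adj a b)
    (h : NonExtendable G v x p q r) : False := by
  obtain ⟨a, hva, hxa, hqa, har⟩ := h.exists_common hL
  obtain ⟨b, hvb, hxb, hpb, hbr⟩ := h.symm.exists_common hL
  have hbr' := List.mem_reverse.1 hbr
  by_cases hap : G.Adj a p
  · exact h.false_of_adj hL hD hS har hva hxa hqa hap.symm
  by_cases hbq : G.Adj b q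
  · exact h.false_of_adj hL hD hS hbr' hvb hxb hbq.symm hpb
  have hab : a ≠ b := by rintro rfl; exact hap hpb.symm
  obtain ⟨r₁, hr₁⟩ := h.eq_cons_of_not_adj hL hD har hbr' hab hva hxa hqa hap hvb hxb
  obtain ⟨r₂, hr₂⟩ := h.symm.eq_cons_of_not_adj hL hD hbr (List.mem_reverse.2 har) hab.symm
    hvb hxb hpb hbq hva hxa
  obtain ⟨s, rfl⟩ : ∃ s, r = a :: (s ++ [b]) := by
    subst hr₁
    obtain rfl | ⟨s, c, rfl⟩ := r₁.eq_nil_or_concat'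
    · simp at hr₂; exact absurd hr₂.1 hab
    · simp at hr₂; exact ⟨s, by rw [hr₂.1]⟩
  have hx := h.notMem
  have hvx := h.adj
  have hvp := h.adj_left
  have hvq := h.adj_right
  have hxp := h.not_adj_left hx hvx.symm
  have hxq := h.not_adj_right hx hvx.symm
  have hc := h.isCycleList.rotate (l' := b :: p :: v :: q :: a :: s)
    (by simpa using List.isRotated_append (l := p :: v :: q :: a :: s) (l' := [b]))
  have hn := hc.nodup
  simp [not_or] at hn hx
  have hpq : G.Adj p q := by
    by_contra hpq
    obtain ⟨c, h₁, h₂, h₃⟩ := hL hvp hvq (by grind) hpq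
    have hc := hD.mem (l := [p, q, x, a, b]) (by simp; grind) rfl (by simp [*]) h₁
    have := h₂.ne
    have := h₃.ne
    have := h₂.symm
    have := h₃.symm
    simp at hc; grind
  refine h.length_ne (b :: x :: v :: p :: q :: a :: s) ⟨?_, by simp, ?_⟩ (by simp) (by simp)
  · simp; grind
  · have hch := hc.chain
    simp only [Cycle.chain_coe_cons, List.cons_append, List.isChain_cons_cons] at hch ⊢
    exact ⟨hxb.symm, hvx.symm, hvp, hpq, hqa, hch.2.2.2.2⟩

end NonExtendable

theorem IsCycleList.exists_isRotated {G : SimpleGraph V} {l : List V} (h : IsCycleList G l) {v : V}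
    (hv : v ∈ l) : ∃ p q r, l ~r (p :: v :: q :: r) := by
  have h3 := h.three_le
  obtain ⟨s, t, rfl⟩ := List.append_of_mem hv
  have hr : (s ++ v :: t) ~r (v :: (t ++ s)) := List.isRotated_append
  generalize t ++ s = u at hr
  have hlen := hr.perm.length_eq
  obtain _ | ⟨q, u⟩ := u
  · simp_all
  obtain rfl | ⟨r, p, rfl⟩ := u.eq_nil_or_concat'
  · simp_all
  · exact ⟨p, q, r, hr.trans (by
      simpa using List.isRotated_append (l := v :: q :: r) (l' := [p]))⟩

theorem IsCycleList.extend {G : SimpleGraph V} (hL : LocallyCommon G) (hD : DegreeLEFive G)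
    (hS : ∀ x y, G.Adj x y → ∃ a b, G.Adj x a ∧ G.Adj x b ∧ a ≠ b ∧ ¬ G.Adj a b)
    {l : List V} (h : IsCycleList G l) {v x : V} (hv : v ∈ l) (hx : x ∉ l) (hvx : G.Adj v x) :
    ∃ l', IsCycleList G l' ∧ v ∈ l' ∧ l'.length = l.length + 1 := by
  obtain ⟨p, q, r, hr⟩ := h.exists_isRotated hv
  by_contra! hcon
  refine NonExtendable.false (v := v) (x := x) (p := p) (q := q) (r := r) hL hD hS
    ⟨h.rotate hr, by rwa [← hr.mem_iff], hvx, fun l' h₁ h₂ => ?_⟩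
  have := hcon l' h₁ h₂
  rw [hr.perm.length_eq] at this
  simpa using this

/-- Without simplicial vertices, cycles of all lengths up to that of a given one exist. -/
theorem IsCycleList.exists_length_eq_of_forall_exists_not_adj {G : SimpleGraph V}
    (hL : LocallyCommon G) (hD : DegreeLEFive G)
    (hS : ∀ x y, G.Adj x y → ∃ a b, G.Adj x a ∧ G.Adj x b ∧ a ≠ b ∧ ¬ G.Adj a b)
    {l : List V} (h : IsCycleList G l) {n : ℕ} (hn : 3 ≤ n) (hnl : n ≤ l.length) :
    ∃ l', IsCycleList G l' ∧ l'.length = n := by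
  classical
  have hreach : ∀ (l : List V), IsCycleList G l → ∀ u ∈ l, ∀ w ∈ l, G.Reachable u w := by
    intro l h u hu w hw
    obtain _ | ⟨a, t⟩ := l
    · simp at hu
    have key : ∀ z ∈ a :: t, G.Reachable a z := by
      intro z hz
      have hch := h.chain
      rw [Cycle.chain_coe_cons] at hch
      have hz' : z ∈ (Walk.ofSupport _ (by simp) hch).support := by
        rw [Walk.support_ofSupport]; grind
      simpa using ((Walk.ofSupport _ (by simp) hch).takeUntil z hz').reachable
    exact (key u hu).symm.trans (key w hw)
  obtain ⟨r₀, hr₀⟩ : ∃ r, r ∈ l := List.exists_mem_of_length_pos (by omega)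
  suffices ∃ l', IsCycleList G l' ∧ l'.length = n ∧ ∃ v ∈ l', G.Reachable v r₀ by
    obtain ⟨l', h₁, h₂, -⟩ := this
    exact ⟨l', h₁, h₂⟩
  induction n, hn using Nat.le_induction with
  | base =>
    obtain ⟨p, q, r, hr⟩ := h.exists_isRotated hr₀
    have hch := (h.rotate hr).chain
    have hnd := (h.rotate hr).nodup
    simp at hch hnd
    have htri : ∀ a b : V, G.Adj r₀ a → G.Adj r₀ b → G.Adj a b →
        ∃ l', IsCycleList G l' ∧ l'.length = 3 ∧ ∃ v ∈ l', G.Reachable v r₀ := by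
      intro a b ha hb hab
      refine ⟨[r₀, a, b], ⟨?_, by simp, ?_⟩, rfl, r₀, by simp, .refl _⟩
      · simp [ha.ne, hb.ne, hab.ne]
      · simp [ha, hb.symm, hab]
    by_cases hpq : G.Adj p q
    · exact htri p q hch.1.symm hch.2.1 hpq
    · obtain ⟨c, h₁, h₂, -⟩ := hL hch.1.symm hch.2.1 (by grind) hpq
      exact htri p c hch.1.symm h₁ h₂
  | succ n hn ih =>
    obtain ⟨l', h', rfl, u, hu, hur⟩ := ih (by omega)
    obtain ⟨y, hy, hy'⟩ : ∃ y ∈ l, y ∉ l' := by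
      by_contra! hcon
      have := (h.nodup.subperm hcon).length_le
      omega
    obtain ⟨w⟩ := hur.trans (hreach l h r₀ hr₀ y hy)
    obtain ⟨d, -, hd₁, hd₂⟩ := w.exists_boundary_dart {z | z ∈ l'} hu hy'
    obtain ⟨l'', h₁, h₂, h₃⟩ := h'.extend hL hD hS hd₁ hd₂ d.adj
    exact ⟨l'', h₁, h₃, d.fst, h₂, (hreach l' h' _ hd₁ u hu).trans hur⟩

theorem LocallyCommon.deleteIncidenceSet {G : SimpleGraph V} (hL : LocallyCommon G) {x : V}
    (hx : ∀ a b, G.Adj x a → G.Adj x b → a ≠ b → G.Adj a b) :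
    LocallyCommon (G.deleteIncidenceSet x) := by
  intro v a b hva hvb hab hnab
  rw [deleteIncidenceSet_adj] at hva hvb hnab
  have hnab' : ¬ G.Adj a b := fun hh => hnab ⟨hh, hva.2.2, hvb.2.2⟩
  obtain ⟨c, h₁, h₂, h₃⟩ := hL hva.1 hvb.1 hab hnab'
  have hcx : c ≠ x := by
    rintro rfl
    exact hnab' (hx a b h₂.symm h₃.symm hab)
  simp only [deleteIncidenceSet_adj]
  exact ⟨c, ⟨h₁, hva.2.1, hcx⟩, ⟨h₂, hva.2.2, hcx⟩, ⟨h₃, hvb.2.2, hcx⟩⟩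

theorem IsCycleList.mono {G H : SimpleGraph V} (hGH : G ≤ H) {l : List V} (h : IsCycleList G l) :
    IsCycleList H l :=
  ⟨h.nodup, h.three_le, h.chain.imp fun _ _ hab => hGH hab⟩

theorem IsCycleList.deleteIncidenceSet {G : SimpleGraph V} {l : List V} (h : IsCycleList G l)
    {x : V} (hx : x ∉ l) : IsCycleList (G.deleteIncidenceSet x) l := by
  refine ⟨h.nodup, h.three_le, ?_⟩
  have hch := h.chain
  obtain _ | ⟨a, t⟩ := l
  · simp
  rw [Cycle.chain_coe_cons] at hch ⊢
  refine hch.imp_of_mem_imp fun y z hy hz hyz => deleteIncidenceSet_adj.2 ⟨hyz, ?_, ?_⟩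
  · rintro rfl; simp at hx hy; tauto
  · rintro rfl; simp at hx hz; tauto

/-- A cycle through a simplicial vertex can be shortened by skipping that vertex. -/
theorem IsCycleList.tail {G : SimpleGraph V} {x : V} {t : List V} (h : IsCycleList G (x :: t))
    (ht : 3 ≤ t.length) (hx : ∀ a b, G.Adj x a → G.Adj x b → a ≠ b → G.Adj a b) :
    IsCycleList G t := by
  obtain ⟨hnd, -, hch⟩ := h
  obtain _ | ⟨a, t⟩ := t
  · simp at ht
  obtain rfl | ⟨s, b, rfl⟩ := t.eq_nil_or_concat'
  · simp at ht
  refine ⟨(List.nodup_cons.1 hnd).2, ht, ?_⟩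
  rw [Cycle.chain_coe_cons] at hch ⊢
  simp only [List.cons_append, List.isChain_cons_cons, List.append_assoc, List.nil_append] at hch ⊢
  have hab : a ≠ b := by simp at hnd; grind
  rw [← List.cons_append, List.isChain_split] at hch ⊢
  simp only [List.isChain_pair] at hch ⊢
  exact ⟨hch.2.1, (hx a b hch.1 hch.2.2.symm hab).symm⟩

theorem IsCycleList.exists_length_eq [Finite V] {G : SimpleGraph V} (hL : LocallyCommon G)
    (hD : DegreeLEFive G) {l : List V} (h : IsCycleList G l) {n : ℕ} (hn : 3 ≤ n)
    (hnl : n ≤ l.length) : ∃ l', IsCycleList G l' ∧ l'.length = n := by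
  induction hm : G.edgeSet.ncard using Nat.strong_induction_on generalizing G l with
  | _ m ih =>
  subst hm
  by_cases hS : ∀ x y, G.Adj x y → ∃ a b, G.Adj x a ∧ G.Adj x b ∧ a ≠ b ∧ ¬ G.Adj a b
  · exact h.exists_length_eq_of_forall_exists_not_adj hL hD hS hn hnl
  push Not at hS
  obtain ⟨x, y, hxy, hx⟩ := hS
  have hle := G.deleteIncidenceSet_le x
  have hlt : (G.deleteIncidenceSet x).edgeSet.ncard < G.edgeSet.ncard := by
    refine Set.ncard_lt_ncard ((Set.ssubset_iff_of_subset (edgeSet_mono hle)).2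
      ⟨s(x, y), hxy, ?_⟩) (Set.toFinite _)
    simp [deleteIncidenceSet_adj]
  have key : ∀ l', IsCycleList (G.deleteIncidenceSet x) l' → n ≤ l'.length →
      ∃ l', IsCycleList G l' ∧ l'.length = n := by
    intro l' h' hl'
    obtain ⟨l'', h₁, h₂⟩ := ih _ hlt (hL.deleteIncidenceSet hx)
      (fun v s hs => hD v s fun y hy => hle (hs y hy)) h' hl' rfl
    exact ⟨l'', h₁.mono hle, h₂⟩
  by_cases hxl : x ∉ l
  · exact key l (h.deleteIncidenceSet hxl) hnl
  obtain ⟨s, t, rfl⟩ := List.append_of_mem (not_not.1 hxl)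
  obtain hnl | hnl := hnl.eq_or_lt
  · exact ⟨_, h, hnl.symm⟩
  have h' := h.rotate (List.isRotated_append (l := s) (l' := x :: t))
  simp only [List.length_append, List.length_cons] at hnl
  have hlen : n ≤ (t ++ s).length := by rw [List.length_append]; omega
  exact key _ ((IsCycleList.tail (t := t ++ s) h' (hn.trans hlen) hx).deleteIncidenceSet (List.nodup_cons.1 h'.nodup).1) hlen

end

/-- Corollary 1: a locally isometric graph with maximum degree at most `5` and
order greater than its maximum degree is weakly pancyclic. -/
theorem locallyIsometric_maxDegree_le_five_weaklyPancyclic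
    {V : Type*} [Fintype V] (G : SimpleGraph V) [DecidableRel G.Adj]
    (hli : LocallyIsometric G) (hmax : G.maxDegree ≤ 5)
    (hn : G.maxDegree < Fintype.card V) :
    WeaklyPancyclic G := by
  rintro n ⟨k, ⟨a, c, hc, rfl⟩, hk⟩ ⟨m, hm, hnm⟩
  obtain ⟨l, hl, rfl⟩ := (isCycleList_iff_isCycle m).2 hm
  refine (isCycleList_iff_isCycle n).1 (hl.exists_length_eq (fun v a b => hli.exists_common)
    (fun v s hs => ?_) (hc.three_le_length.trans hk) hnm)
  refine le_trans ?_ ((G.degree_le_maxDegree v).trans hmax)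
  exact Finset.card_le_card fun y hy => (G.mem_neighborFinset v y).2 (hs y hy)
end
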